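/- arXiv:2003.05180 — 3 statements merged into one kernel-verified Lean document; each statement's English description precedes it below -/
import Mathlib

section
/- For every α ∈ [1/2, 1] there exists a Borel probability measure μ_α on [α−1, α) that is invariant under T_α, ergodic for T_α, and equivalent to Lebesgue measure. -/
open MeasureTheory Set

noncomputable def g : ℝ := (Real.sqrt 5 - 1) / 2

noncomputable def T (α : ℝ) (x : ℝ) : ℝ :=
  if x = 0 then 0 else 1 / x - ⌊1 / x + 1 - α⌋

noncomputable def digit (α : ℝ) (k : ℕ) (x : ℝ) : ℤ :=
  if (T α)^[k - 1] x = 0 then 0 else ⌊1 / ((T α)^[k - 1] x) + 1 - α⌋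

noncomputable def cylinder (α : ℝ) (n : ℕ) (a : ℕ → ℤ) : Set ℝ :=
  {x | x ∈ Set.Ico (α - 1) α ∧ ∀ k, 1 ≤ k → k ≤ n → digit α k x = a k}

def contQ (a : ℕ → ℤ) : ℕ → ℤ
  | 0 => 1
  | 1 => a 1
  | (n + 2) => a (n + 2) * contQ a (n + 1) + contQ a n

def contP (a : ℕ → ℤ) : ℕ → ℤ
  | 0 => 0
  | 1 => 1
  | (n + 2) => a (n + 2) * contP a (n + 1) + contP a n

noncomputable def NT (α : ℝ) (p : ℝ × ℝ) : ℝ × ℝ :=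
  if p.1 = 0 then (0, 0)
  else (1 / p.1 - ⌊1 / p.1 + 1 - α⌋, 1 / (p.2 + ⌊1 / p.1 + 1 - α⌋))

noncomputable def Omega (α : ℝ) : Set (ℝ × ℝ) :=
  ⋃ n : ℕ, closure ((NT α)^[n] '' (Set.Ico (α - 1) α ×ˢ ({0} : Set ℝ)))

def Sset (x y : ℝ) : Set (ℝ × ℝ) :=
  {(x, y), (-x, -y), (x + 1, y / (1 - y)), (1 - x, -y / (y + 1))}

noncomputable def jumpTime (α : ℝ) (x : ℝ) : ℕ :=
  sInf {n : ℕ | 1 ≤ n ∧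
    (T α)^[n] '' cylinder α n (fun k => digit α k x) = Set.Ico (α - 1) α}

noncomputable def jumpT (α : ℝ) (x : ℝ) : ℝ := (T α)^[jumpTime α x] x

/-- The points `x` and `y` share their first `n` digits. -/
def SameDigits (α : ℝ) (n : ℕ) (x y : ℝ) : Prop :=
  ∀ k < n, digit α 1 ((T α)^[k] x) = digit α 1 ((T α)^[k] y)

/-- The set of points of the domain which share their first `n` digits with `x`. -/
def cyl (α : ℝ) (n : ℕ) (x : ℝ) : Set ℝ :=
  {y | y ∈ Ico (α - 1) α ∧ SameDigits α n x y}

/-- The points of the domain lying in a cylinder of order `n` mapped onto the domain. -/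
def fullSet (α : ℝ) (n : ℕ) : Set ℝ :=
  {x | x ∈ Ico (α - 1) α ∧ (T α)^[n] '' cyl α n x = Ico (α - 1) α}

/-- The points of `J` whose cylinders relative to `J`, of order `1` to `m`, are all not mapped
onto the domain. -/
def nonFull (α : ℝ) (m : ℕ) (J : Set ℝ) : Set ℝ :=
  {x | x ∈ J ∧ ∀ j, 1 ≤ j → j ≤ m → (T α)^[j] '' (J ∩ cyl α j x) ≠ Ico (α - 1) α}

/-- The image of the part of `J` with first digit `d`. -/
def childImage (α : ℝ) (J : Set ℝ) (d : ℤ) : Set ℝ :=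
  T α '' {y | y ∈ J ∧ digit α 1 y = d}

/-- The product of the absolute values along the orbit; its square is the inverse of the
derivative of `(T α)^[n]`. -/
noncomputable def weight (α : ℝ) (n : ℕ) (x : ℝ) : ℝ :=
  ∏ k ∈ Finset.range n, |(T α)^[k] x|

section Digits

variable {α : ℝ}

lemma digit_one_zero : digit α 1 0 = 0 := by simp [digit]

lemma digit_one_of_ne {x : ℝ} (hx : x ≠ 0) : digit α 1 x = ⌊1 / x + 1 - α⌋ := by
  simp [digit, hx]

lemma T_of_ne {x : ℝ} (hx : x ≠ 0) : T α x = 1 / x - digit α 1 x := by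
  rw [digit_one_of_ne hx, T, if_neg hx]

lemma T_zero : T α 0 = 0 := by simp [T]

lemma T_mem (hα : α ∈ Icc (1 / 2 : ℝ) 1) (x : ℝ) : T α x ∈ Ico (α - 1) α := by
  obtain ⟨h1, h2⟩ := hα
  by_cases hx : x = 0
  · subst hx
    rw [T_zero]
    constructor <;> linarith
  · rw [T, if_neg hx]
    have h3 := Int.floor_le (1 / x + 1 - α)
    have h4 := Int.lt_floor_add_one (1 / x + 1 - α)
    constructor <;> linarith

lemma iterate_mem (hα : α ∈ Icc (1 / 2 : ℝ) 1) {x : ℝ} (hx : x ∈ Ico (α - 1) α) (n : ℕ) :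
    (T α)^[n] x ∈ Ico (α - 1) α := by
  cases n with
  | zero => exact hx
  | succ n => rw [Function.iterate_succ_apply']; exact T_mem hα _

lemma abs_le_one (hα : α ∈ Icc (1 / 2 : ℝ) 1) {x : ℝ} (hx : x ∈ Ico (α - 1) α) : |x| ≤ 1 := by
  obtain ⟨h1, h2⟩ := hα
  rw [abs_le]
  constructor <;> linarith [hx.1, hx.2]

lemma abs_sub_le_one {x y : ℝ} (hx : x ∈ Ico (α - 1) α) (hy : y ∈ Ico (α - 1) α) :
    |x - y| ≤ 1 := by
  rw [abs_le]
  constructor <;> linarith [hx.1, hx.2, hy.1, hy.2]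

lemma one_le_digit (hα : α ∈ Icc (1 / 2 : ℝ) 1) {x : ℝ} (hx : x ∈ Ico (α - 1) α) (h0 : 0 < x) :
    1 ≤ digit α 1 x := by
  rw [digit_one_of_ne h0.ne', Int.le_floor]
  have : 1 ≤ 1 / x := by
    rw [le_div_iff₀ h0]; linarith [hx.2, hα.2]
  push_cast
  linarith [hα.2]

lemma digit_le_neg_one (hα : α ∈ Icc (1 / 2 : ℝ) 1) {x : ℝ} (hx : x ∈ Ico (α - 1) α)
    (h0 : x < 0) : digit α 1 x ≤ -1 := by
  rw [digit_one_of_ne h0.ne, ← Int.lt_add_one_iff, Int.floor_lt]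
  have : 1 / x ≤ -1 := by
    rw [div_le_iff_of_neg h0]; linarith [hx.1, hα.1]
  push_cast
  linarith [hα.1]

lemma digit_eq_zero_iff (hα : α ∈ Icc (1 / 2 : ℝ) 1) {x : ℝ} (hx : x ∈ Ico (α - 1) α) :
    digit α 1 x = 0 ↔ x = 0 := by
  constructor
  · intro h
    rcases lt_trichotomy x 0 with h0 | h0 | h0
    · have := digit_le_neg_one hα hx h0; omega
    · exact h0
    · have := one_le_digit hα hx h0; omega
  · rintro rfl; exact digit_one_zero

lemma abs_sub_eq (hα : α ∈ Icc (1 / 2 : ℝ) 1) {x y : ℝ} (hx : x ∈ Ico (α - 1) α)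
    (hy : y ∈ Ico (α - 1) α) (h : digit α 1 x = digit α 1 y) :
    |x - y| = |x| * |y| * |T α x - T α y| := by
  by_cases h0 : x = 0
  · have : y = 0 := by rw [← digit_eq_zero_iff hα hy, ← h, h0, digit_one_zero]
    simp [h0, this]
  · have h0' : y ≠ 0 := by
      rwa [Ne, ← digit_eq_zero_iff hα hy, ← h, digit_eq_zero_iff hα hx]
    rw [T_of_ne h0, T_of_ne h0', h, ← abs_mul, ← abs_mul, abs_sub_comm]
    congr 1
    field_simp
    ring

lemma abs_le_of_digit_ne_one (hα : α ∈ Icc (1 / 2 : ℝ) 1) {x : ℝ} (hx : x ∈ Ico (α - 1) α)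
    (h : digit α 1 x ≠ 1) : |x| ≤ 2 / 3 := by
  obtain ⟨h1, h2⟩ := hα
  rcases le_or_gt x 0 with h0 | h0
  · rw [abs_of_nonpos h0]; linarith [hx.1]
  · rw [abs_of_pos h0]
    have h3 := one_le_digit ⟨h1, h2⟩ hx h0
    have h4 : 2 ≤ digit α 1 x := by omega
    rw [digit_one_of_ne h0.ne', Int.le_floor] at h4
    push_cast at h4
    have h5 : 3 / 2 ≤ 1 / x := by linarith
    rw [le_div_iff₀ h0] at h5
    linarith

lemma abs_mul_abs_T_le_of_digit_eq_one (hα : α ∈ Icc (1 / 2 : ℝ) 1) {x : ℝ}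
    (hx : x ∈ Ico (α - 1) α) (h : digit α 1 x = 1) : |x| * |T α x| ≤ 1 / 2 := by
  rcases lt_trichotomy x 0 with h0 | h0 | h0
  · have := digit_le_neg_one hα hx h0; omega
  · rw [h0]; norm_num
  · obtain ⟨h1, h2⟩ := hα
    rw [T_of_ne h0.ne', h, ← abs_mul]
    have e : x * (1 / x - ((1 : ℤ) : ℝ)) = 1 - x := by push_cast; field_simp
    have h4 : digit α 1 x < 2 := by omega
    rw [digit_one_of_ne h0.ne', Int.floor_lt] at h4
    push_cast at h4
    have h5 : 1 / x < 2 := by linarith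
    rw [div_lt_iff₀ h0] at h5
    rw [e, abs_le]
    constructor <;> linarith [hx.2]

lemma abs_mul_abs_T_le (hα : α ∈ Icc (1 / 2 : ℝ) 1) {x : ℝ} (hx : x ∈ Ico (α - 1) α) :
    |x| * |T α x| ≤ 2 / 3 := by
  by_cases h : digit α 1 x = 1
  · linarith [abs_mul_abs_T_le_of_digit_eq_one hα hx h]
  · nlinarith [abs_le_of_digit_ne_one hα hx h, abs_le_one hα (T_mem hα x), abs_nonneg x,
      abs_nonneg (T α x)]

lemma sameDigits_succ {n : ℕ} {x y : ℝ} :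
    SameDigits α (n + 1) x y ↔ digit α 1 x = digit α 1 y ∧ SameDigits α n (T α x) (T α y) := by
  constructor
  · intro h
    exact ⟨h 0 (by omega), fun k hk => h (k + 1) (by omega)⟩
  · rintro ⟨h, h'⟩ (_ | k) hk
    · exact h
    · exact h' k (by omega)

lemma sameDigits_add {k j : ℕ} {x y : ℝ} :
    SameDigits α (k + j) x y ↔
      SameDigits α k x y ∧ SameDigits α j ((T α)^[k] x) ((T α)^[k] y) := by
  constructor
  · intro h
    refine ⟨fun i hi => h i (by omega), fun i hi => ?_⟩
    rw [← Function.iterate_add_apply, ← Function.iterate_add_apply]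
    exact h _ (by omega)
  · rintro ⟨h, h'⟩ i hi
    rcases lt_or_ge i k with hik | hik
    · exact h i hik
    · have := h' (i - k) (by omega)
      rwa [← Function.iterate_add_apply, ← Function.iterate_add_apply,
        Nat.sub_add_cancel hik] at this

lemma SameDigits.symm {n : ℕ} {x y : ℝ} (h : SameDigits α n x y) : SameDigits α n y x :=
  fun k hk => (h k hk).symm

lemma SameDigits.trans {n : ℕ} {x y z : ℝ} (h : SameDigits α n x y) (h' : SameDigits α n y z) :
    SameDigits α n x z :=
  fun k hk => (h k hk).trans (h' k hk)

lemma mem_cyl_self {n : ℕ} {x : ℝ} (hx : x ∈ Ico (α - 1) α) : x ∈ cyl α n x :=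
  ⟨hx, fun _ _ => rfl⟩

end Digits

section Distortion

variable {α : ℝ}

lemma weight_zero (x : ℝ) : weight α 0 x = 1 := by simp [weight]

lemma weight_succ (n : ℕ) (x : ℝ) : weight α (n + 1) x = |x| * weight α n (T α x) := by
  rw [weight, Finset.prod_range_succ', mul_comm]
  rfl

lemma weight_nonneg (n : ℕ) (x : ℝ) : 0 ≤ weight α n x :=
  Finset.prod_nonneg fun _ _ => abs_nonneg _

lemma abs_sub_eq_weight (hα : α ∈ Icc (1 / 2 : ℝ) 1) (n : ℕ) {x y : ℝ}
    (hx : x ∈ Ico (α - 1) α) (hy : y ∈ Ico (α - 1) α) (h : SameDigits α n x y) :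
    |x - y| = weight α n x * weight α n y * |(T α)^[n] x - (T α)^[n] y| := by
  induction n generalizing x y with
  | zero => simp [weight_zero]
  | succ n ih =>
    rw [sameDigits_succ] at h
    rw [abs_sub_eq hα hx hy h.1, ih (T_mem hα x) (T_mem hα y) h.2, weight_succ, weight_succ,
      Function.iterate_succ_apply, Function.iterate_succ_apply]
    ring

lemma weight_le (hα : α ∈ Icc (1 / 2 : ℝ) 1) (n : ℕ) {x : ℝ} (hx : x ∈ Ico (α - 1) α) :
    weight α n x ≤ 3 / 2 * (9 / 10) ^ n := by
  induction n using Nat.twoStepInduction generalizing x with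
  | zero => rw [weight_zero]; norm_num
  | one => rw [weight_succ, weight_zero]; linarith [abs_le_one hα hx]
  | more n ih _ =>
    rw [weight_succ, weight_succ, ← mul_assoc]
    calc |x| * |T α x| * weight α n (T α (T α x))
        ≤ 2 / 3 * (3 / 2 * (9 / 10) ^ n) :=
          mul_le_mul (abs_mul_abs_T_le hα hx) (ih (T_mem hα _)) (weight_nonneg _ _) (by norm_num)
      _ ≤ _ := by
          rw [pow_add]
          nlinarith [show (0 : ℝ) < (9 / 10) ^ n by positivity]

lemma weight_le_one (hα : α ∈ Icc (1 / 2 : ℝ) 1) (n : ℕ) {x : ℝ} (hx : x ∈ Ico (α - 1) α) :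
    weight α n x ≤ 1 :=
  Finset.prod_le_one (fun _ _ => abs_nonneg _) fun k _ => abs_le_one hα (iterate_mem hα hx k)

lemma abs_sub_le_of_sameDigits (hα : α ∈ Icc (1 / 2 : ℝ) 1) (n : ℕ) {x y : ℝ}
    (hx : x ∈ Ico (α - 1) α) (hy : y ∈ Ico (α - 1) α) (h : SameDigits α n x y) :
    |x - y| ≤ 3 / 2 * (9 / 10) ^ n := by
  rw [abs_sub_eq_weight hα n hx hy h, mul_assoc]
  calc _ ≤ 3 / 2 * (9 / 10) ^ n * (1 * 1) :=
        mul_le_mul (weight_le hα n hx)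
          (mul_le_mul (weight_le_one hα n hy)
            (abs_sub_le_one (iterate_mem hα hx n) (iterate_mem hα hy n)) (abs_nonneg _)
            zero_le_one)
          (mul_nonneg (weight_nonneg _ _) (abs_nonneg _)) (by positivity)
    _ = _ := by ring

lemma weight_le_exp_mul (hα : α ∈ Icc (1 / 2 : ℝ) 1) (n : ℕ) {x y : ℝ}
    (hx : x ∈ Ico (α - 1) α) (hy : y ∈ Ico (α - 1) α) (h : SameDigits α n x y) :
    weight α n x ≤ Real.exp (15 * (1 - (9 / 10) ^ n)) * weight α n y := by
  induction n generalizing x y with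
  | zero => simp [weight_zero]
  | succ n ih =>
    rw [sameDigits_succ] at h
    have hxy : |x| ≤ |y| * Real.exp (3 / 2 * (9 / 10) ^ n) := by
      have h1 := abs_sub_eq hα hx hy h.1
      have h2 := abs_sub_le_of_sameDigits hα n (T_mem hα x) (T_mem hα y) h.2
      have h3 : |x - y| ≤ |y| * (3 / 2 * (9 / 10) ^ n) := by
        rw [h1, mul_comm |x|, mul_assoc]
        refine mul_le_mul_of_nonneg_left ?_ (abs_nonneg _)
        nlinarith [abs_le_one hα hx, abs_nonneg (T α x - T α y), abs_nonneg x]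
      have h4 := Real.add_one_le_exp (3 / 2 * (9 / 10 : ℝ) ^ n)
      have h5 : |x| ≤ |y| + |x - y| := by
        have := abs_add_le y (x - y)
        rwa [add_sub_cancel] at this
      nlinarith [abs_nonneg y]
    rw [weight_succ, weight_succ]
    calc |x| * weight α n (T α x)
        ≤ (|y| * Real.exp (3 / 2 * (9 / 10) ^ n)) *
          (Real.exp (15 * (1 - (9 / 10) ^ n)) * weight α n (T α y)) :=
          mul_le_mul hxy (ih (T_mem hα x) (T_mem hα y) h.2) (weight_nonneg _ _) (by positivity)
      _ = Real.exp (3 / 2 * (9 / 10) ^ n + 15 * (1 - (9 / 10) ^ n)) *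
          (|y| * weight α n (T α y)) := by rw [Real.exp_add]; ring
      _ = _ := by congr 2; ring

lemma weight_le_mul (hα : α ∈ Icc (1 / 2 : ℝ) 1) (n : ℕ) {x y : ℝ}
    (hx : x ∈ Ico (α - 1) α) (hy : y ∈ Ico (α - 1) α) (h : SameDigits α n x y) :
    weight α n x ≤ Real.exp 15 * weight α n y := by
  refine (weight_le_exp_mul hα n hx hy h).trans ?_
  refine mul_le_mul_of_nonneg_right (Real.exp_le_exp.2 ?_) (weight_nonneg _ _)
  linarith [show (0 : ℝ) < (9 / 10) ^ n by positivity]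

lemma volume_image_le_of_lipschitz {f : ℝ → ℝ} {S : Set ℝ} {c : ℝ} (hc : 0 ≤ c)
    (h : ∀ x ∈ S, ∀ y ∈ S, |f x - f y| ≤ c * |x - y|) :
    volume (f '' S) ≤ ENNReal.ofReal c * volume S := by
  have hl : LipschitzOnWith c.toNNReal f S := by
    refine LipschitzOnWith.of_dist_le_mul fun x hx y hy => ?_
    rw [Real.dist_eq, Real.dist_eq, Real.coe_toNNReal c hc]
    exact h x hx y hy
  have := hl.hausdorffMeasure_image_le (d := 1) zero_le_one
  rwa [hausdorffMeasure_real, ENNReal.rpow_one] at this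

lemma volume_le_of_antilipschitz {f : ℝ → ℝ} {S : Set ℝ} {c : ℝ} (hc : 0 ≤ c)
    (h : ∀ x ∈ S, ∀ y ∈ S, |x - y| ≤ c * |f x - f y|) :
    volume S ≤ ENNReal.ofReal c * volume (f '' S) := by
  have hinj : InjOn f S := fun x hx y hy hxy => by
    have := h x hx y hy
    rw [hxy, sub_self, abs_zero, mul_zero] at this
    exact sub_eq_zero.1 (abs_nonpos_iff.1 this)
  have hinv := hinj.leftInvOn_invFunOn
  have e : Function.invFunOn f S '' (f '' S) = S := hinv.image_image
  conv_lhs => rw [← e]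
  refine volume_image_le_of_lipschitz hc ?_
  rintro _ ⟨x, hx, rfl⟩ _ ⟨y, hy, rfl⟩
  rw [hinv hx, hinv hy]
  exact h x hx y hy

lemma volume_domain : volume (Ico (α - 1) α) = 1 := by
  rw [Real.volume_Ico]; simp

lemma weight_pos_of_mem_fullSet (hα : α ∈ Icc (1 / 2 : ℝ) 1) {n : ℕ} {x : ℝ}
    (hx : x ∈ fullSet α n) : 0 < weight α n x := by
  by_contra! h0
  have hw : weight α n x = 0 := le_antisymm h0 (weight_nonneg _ _)
  have hs : cyl α n x ⊆ {x} := fun y hy => by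
    have := abs_sub_eq_weight hα n hx.1 hy.1 hy.2
    rw [hw, zero_mul, zero_mul, abs_eq_zero, sub_eq_zero] at this
    exact this.symm
  have h1 : volume ((T α)^[n] '' cyl α n x) ≤ volume ((T α)^[n] '' {x}) :=
    measure_mono (image_mono hs)
  rw [hx.2, volume_domain, image_singleton, Real.volume_singleton] at h1
  exact absurd h1 (by simp)

lemma volume_le_weight (hα : α ∈ Icc (1 / 2 : ℝ) 1) {n : ℕ} {x : ℝ} (hx : x ∈ Ico (α - 1) α)
    {S : Set ℝ} (hS : S ⊆ cyl α n x) :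
    volume S ≤ ENNReal.ofReal ((Real.exp 15 * weight α n x) ^ 2) * volume ((T α)^[n] '' S) := by
  refine volume_le_of_antilipschitz (by positivity) fun y hy z hz => ?_
  have hy' := hS hy
  have hz' := hS hz
  rw [abs_sub_eq_weight hα n hy'.1 hz'.1 (hy'.2.symm.trans hz'.2), sq]
  refine mul_le_mul_of_nonneg_right ?_ (abs_nonneg _)
  exact mul_le_mul (weight_le_mul hα n hy'.1 hx hy'.2.symm) (weight_le_mul hα n hz'.1 hx hz'.2.symm)
    (weight_nonneg _ _) (mul_nonneg (Real.exp_pos _).le (weight_nonneg _ _))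

lemma volume_image_le_weight (hα : α ∈ Icc (1 / 2 : ℝ) 1) {n : ℕ} {x : ℝ} (hx : x ∈ fullSet α n)
    {S : Set ℝ} (hS : S ⊆ cyl α n x) :
    volume ((T α)^[n] '' S) ≤ ENNReal.ofReal ((Real.exp 15 / weight α n x) ^ 2) * volume S := by
  have hw := weight_pos_of_mem_fullSet hα hx
  refine volume_image_le_of_lipschitz (by positivity) fun y hy z hz => ?_
  have hy' := hS hy
  have hz' := hS hz
  rw [abs_sub_eq_weight hα n hy'.1 hz'.1 (hy'.2.symm.trans hz'.2)]
  have h1 := weight_le_mul hα n hx.1 hy'.1 hy'.2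
  have h2 := weight_le_mul hα n hx.1 hz'.1 hz'.2
  have h3 : weight α n x ^ 2 ≤ Real.exp 15 ^ 2 * (weight α n y * weight α n z) := by
    calc _ = weight α n x * weight α n x := sq _
      _ ≤ _ := mul_le_mul h1 h2 hw.le (h1.trans' hw.le)
      _ = _ := by ring
  have h4 : 1 ≤ (Real.exp 15 / weight α n x) ^ 2 * (weight α n y * weight α n z) := by
    rw [div_pow, div_mul_eq_mul_div, le_div_iff₀ (by positivity)]
    linarith
  rw [← mul_assoc]
  nlinarith [abs_nonneg ((T α)^[n] y - (T α)^[n] z)]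

lemma volume_cyl_inter_preimage_le (hα : α ∈ Icc (1 / 2 : ℝ) 1) {n : ℕ} {x : ℝ}
    (hx : x ∈ fullSet α n) (B : Set ℝ) :
    volume (cyl α n x ∩ (T α)^[n] ⁻¹' B) ≤
      ENNReal.ofReal (Real.exp 15 ^ 4) * volume (cyl α n x) * volume B := by
  have hw := weight_pos_of_mem_fullSet hα hx
  have h1 : 1 ≤ ENNReal.ofReal ((Real.exp 15 / weight α n x) ^ 2) * volume (cyl α n x) := by
    have := volume_image_le_weight hα hx Subset.rfl
    rwa [hx.2, volume_domain] at this
  calc volume (cyl α n x ∩ (T α)^[n] ⁻¹' B)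
      ≤ ENNReal.ofReal ((Real.exp 15 * weight α n x) ^ 2) *
          volume ((T α)^[n] '' (cyl α n x ∩ (T α)^[n] ⁻¹' B)) :=
        volume_le_weight hα hx.1 inter_subset_left
    _ ≤ ENNReal.ofReal ((Real.exp 15 * weight α n x) ^ 2) * volume B := by
        gcongr
        rintro _ ⟨y, hy, rfl⟩
        exact hy.2
    _ ≤ ENNReal.ofReal ((Real.exp 15 * weight α n x) ^ 2) *
          (ENNReal.ofReal ((Real.exp 15 / weight α n x) ^ 2) * volume (cyl α n x)) * volume B := by
        gcongr
        exact le_mul_of_one_le_right' h1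
    _ = _ := by
        rw [← mul_assoc, ← ENNReal.ofReal_mul (by positivity)]
        congr 3
        field_simp

end Distortion

section Measurability

variable {α : ℝ}

lemma measurable_digit_one : Measurable (digit α 1) := by
  unfold digit
  refine Measurable.ite (measurableSet_eq_fun (by simpa using measurable_id) measurable_const)
    measurable_const (Int.measurable_floor.comp ?_)
  simp only [Nat.sub_self, Function.iterate_zero, id]
  fun_prop

lemma measurable_T : Measurable (T α) := by
  unfold T
  refine Measurable.ite (measurableSet_singleton 0) measurable_const ?_
  have : Measurable fun x : ℝ => ⌊1 / x + 1 - α⌋ := Int.measurable_floor.comp (by fun_prop)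
  fun_prop

/-- The word formed by the first `n` digits of `x`. -/
noncomputable def digitWord (α : ℝ) (n : ℕ) (x : ℝ) : Fin n → ℤ :=
  fun k => digit α 1 ((T α)^[k] x)

lemma measurable_digitWord (n : ℕ) : Measurable (digitWord α n) :=
  measurable_pi_lambda _ fun k => measurable_digit_one.comp (measurable_T.iterate k)

lemma cyl_eq_digitWord (n : ℕ) (x : ℝ) :
    cyl α n x = digitWord α n ⁻¹' {digitWord α n x} ∩ Ico (α - 1) α := by
  ext y
  simp only [cyl, SameDigits, digitWord, mem_ofPred_eq, mem_inter_iff, mem_preimage,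
    mem_singleton_iff, funext_iff]
  rw [and_comm]
  refine and_congr_left fun _ => ⟨fun h k => (h k k.2).symm, fun h k hk => (h ⟨k, hk⟩).symm⟩

lemma volume_fullSet_inter_preimage_le (hα : α ∈ Icc (1 / 2 : ℝ) 1) (n : ℕ) (B : Set ℝ) :
    volume (fullSet α n ∩ (T α)^[n] ⁻¹' B) ≤ ENNReal.ofReal (Real.exp 15 ^ 4) * volume B := by
  set C := ENNReal.ofReal (Real.exp 15 ^ 4)
  have hfib (c : Fin n → ℤ) :
      volume (fullSet α n ∩ (T α)^[n] ⁻¹' B ∩ digitWord α n ⁻¹' {c}) ≤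
        C * volume (digitWord α n ⁻¹' {c} ∩ Ico (α - 1) α) * volume B := by
    rcases (fullSet α n ∩ (T α)^[n] ⁻¹' B ∩ digitWord α n ⁻¹' {c}).eq_empty_or_nonempty with
      h | ⟨x, ⟨hx, _⟩, hxc⟩
    · rw [h, measure_empty]; exact zero_le
    · have hc : digitWord α n x = c := hxc
      have := volume_cyl_inter_preimage_le hα hx B
      rw [cyl_eq_digitWord, hc] at this
      refine (measure_mono ?_).trans this
      rintro y ⟨⟨hy, hyB⟩, hyc⟩
      exact ⟨⟨hyc, hy.1⟩, hyB⟩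
  have hsum : ∑' c, volume (digitWord α n ⁻¹' {c} ∩ Ico (α - 1) α) ≤ 1 := by
    rw [← volume_domain (α := α), ← measure_iUnion]
    · exact measure_mono (iUnion_subset fun _ => inter_subset_right)
    · intro c d hcd
      refine Set.disjoint_left.2 ?_
      rintro y ⟨h1, _⟩ ⟨h2, _⟩
      exact hcd (h1.symm.trans h2)
    · exact fun c => (measurable_digitWord n (measurableSet_singleton c)).inter measurableSet_Ico
  calc volume (fullSet α n ∩ (T α)^[n] ⁻¹' B)
      ≤ volume (⋃ c, fullSet α n ∩ (T α)^[n] ⁻¹' B ∩ digitWord α n ⁻¹' {c}) :=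
        measure_mono fun x hx => mem_iUnion.2 ⟨digitWord α n x, hx, rfl⟩
    _ ≤ ∑' c, volume (fullSet α n ∩ (T α)^[n] ⁻¹' B ∩ digitWord α n ⁻¹' {c}) :=
        measure_iUnion_le _
    _ ≤ ∑' c, C * volume (digitWord α n ⁻¹' {c} ∩ Ico (α - 1) α) * volume B :=
        ENNReal.tsum_le_tsum hfib
    _ = C * (∑' c, volume (digitWord α n ⁻¹' {c} ∩ Ico (α - 1) α)) * volume B := by
        rw [ENNReal.tsum_mul_right, ENNReal.tsum_mul_left]
    _ ≤ C * 1 * volume B := by gcongr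
    _ = _ := by rw [mul_one]

end Measurability

section Structure

variable {α : ℝ}

lemma digit_eq_of_mem_uIcc {u y x : ℝ} (h0 : 0 < u * y) (h : digit α 1 u = digit α 1 y)
    (hx : x ∈ uIcc u y) : digit α 1 x = digit α 1 y := by
  wlog huy : u ≤ y generalizing u y
  · rw [← h]
    exact this (by rwa [mul_comm]) h.symm (by rwa [uIcc_comm]) (le_of_not_ge huy)
  rw [uIcc_of_le huy] at hx
  have hu0 : u ≠ 0 := by rintro rfl; simp at h0
  have hy0 : y ≠ 0 := by rintro rfl; simp at h0
  have hinv : x ≠ 0 ∧ 1 / y ≤ 1 / x ∧ 1 / x ≤ 1 / u := by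
    rcases lt_or_gt_of_ne hu0 with hu | hu
    · have hy : y < 0 := by nlinarith
      have hx0 : x < 0 := hx.2.trans_lt hy
      exact ⟨hx0.ne, one_div_le_one_div_of_neg_of_le hy hx.2,
        one_div_le_one_div_of_neg_of_le hx0 hx.1⟩
    · have hx0 : 0 < x := hu.trans_le hx.1
      exact ⟨hx0.ne', one_div_le_one_div_of_le hx0 hx.2, one_div_le_one_div_of_le hu hx.1⟩
  obtain ⟨hx0, h1, h2⟩ := hinv
  rw [digit_one_of_ne hu0, digit_one_of_ne hy0] at h
  rw [digit_one_of_ne hx0, digit_one_of_ne hy0]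
  refine le_antisymm ?_ (Int.floor_mono (by linarith))
  rw [← h]
  exact Int.floor_mono (by linarith)

/-- The inverse branch `t ↦ 1 / (t + d)` attached to the digit `d` of `y`. -/
lemma inverse_branch (hα : α ∈ Icc (1 / 2 : ℝ) 1) {y t : ℝ} (hy : y ∈ Ico (α - 1) α)
    (hy0 : y ≠ 0) (ht : t ∈ Ico (α - 1) α) :
    0 < 1 / (t + digit α 1 y) * y ∧ digit α 1 (1 / (t + digit α 1 y)) = digit α 1 y ∧
      T α (1 / (t + digit α 1 y)) = t := by
  have hs : 0 < 1 / (t + digit α 1 y) * y := by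
    rcases lt_or_gt_of_ne hy0 with h | h
    · have h1 : (digit α 1 y : ℝ) ≤ -1 := by exact_mod_cast digit_le_neg_one hα hy h
      have : t + digit α 1 y < 0 := by linarith [ht.2, hα.2]
      exact mul_pos_of_neg_of_neg (one_div_neg.2 this) h
    · have h1 : (1 : ℝ) ≤ digit α 1 y := by exact_mod_cast one_le_digit hα hy h
      have : 0 < t + digit α 1 y := by linarith [ht.1, hα.1]
      exact mul_pos (one_div_pos.2 this) h
  have hu0 : 1 / (t + digit α 1 y) ≠ 0 := left_ne_zero_of_mul hs.ne'
  have hd : digit α 1 (1 / (t + digit α 1 y)) = digit α 1 y := by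
    rw [digit_one_of_ne hu0, one_div_one_div, Int.floor_eq_iff]
    constructor <;> linarith [ht.1, ht.2]
  refine ⟨hs, hd, ?_⟩
  rw [T_of_ne hu0, hd, one_div_one_div, add_sub_cancel_right]

lemma one_div_T_add_digit {x : ℝ} (hx : x ≠ 0) : 1 / (T α x + digit α 1 x) = x := by
  rw [T_of_ne hx, sub_add_cancel, one_div_one_div]

lemma childImage_eq_of_between (hα : α ∈ Icc (1 / 2 : ℝ) 1) {J : Set ℝ} (hJ : J.OrdConnected)
    (hJI : J ⊆ Ico (α - 1) α) {x y z : ℝ} (hx : x ∈ J) (hy : y ∈ J) (hz : z ∈ J) (hxy : x < y)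
    (hyz : y < z) (hy0 : y ≠ 0) (hdx : digit α 1 x ≠ digit α 1 y)
    (hdz : digit α 1 z ≠ digit α 1 y) :
    childImage α J (digit α 1 y) = Ico (α - 1) α := by
  apply Subset.antisymm
  · rintro _ ⟨u, _, rfl⟩
    exact T_mem hα u
  · intro t ht
    obtain ⟨h1, h2, h3⟩ := inverse_branch hα (hJI hy) hy0 ht
    refine ⟨_, ⟨hJ.out hx hz ⟨?_, ?_⟩, h2⟩, h3⟩
    · by_contra! hlt
      exact hdx (digit_eq_of_mem_uIcc h1 h2 (mem_uIcc_of_le hlt.le hxy.le))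
    · by_contra! hlt
      exact hdz (digit_eq_of_mem_uIcc h1 h2 (mem_uIcc_of_ge hyz.le hlt.le))

lemma ordConnected_childImage (hα : α ∈ Icc (1 / 2 : ℝ) 1) {J : Set ℝ} (hJ : J.OrdConnected)
    (hJI : J ⊆ Ico (α - 1) α) (d : ℤ) : (childImage α J d).OrdConnected := by
  refine ⟨?_⟩
  rintro _ ⟨a, ⟨ha, had⟩, rfl⟩ _ ⟨b, ⟨hb, hbd⟩, rfl⟩ t ⟨hat, htb⟩
  have ht : t ∈ Ico (α - 1) α := ⟨(T_mem hα a).1.trans hat, htb.trans_lt (T_mem hα b).2⟩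
  by_cases hd0 : d = 0
  · have ha0 := (digit_eq_zero_iff hα (hJI ha)).1 (had.trans hd0)
    have hb0 := (digit_eq_zero_iff hα (hJI hb)).1 (hbd.trans hd0)
    rw [ha0, T_zero] at hat
    rw [hb0, T_zero] at htb
    exact ⟨a, ⟨ha, had⟩, by rw [ha0, T_zero]; exact le_antisymm hat htb⟩
  · have ha0 : a ≠ 0 := by rwa [Ne, ← digit_eq_zero_iff hα (hJI ha), had]
    have hb0 : b ≠ 0 := by rwa [Ne, ← digit_eq_zero_iff hα (hJI hb), hbd]
    obtain ⟨h1, h2, h3⟩ := inverse_branch hα (hJI ha) ha0 ht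
    have hea := one_div_T_add_digit (α := α) ha0
    have heb := one_div_T_add_digit (α := α) hb0
    rw [had] at h1 h2 h3 hea
    rw [hbd] at heb
    refine ⟨_, ⟨?_, h2⟩, h3⟩
    rcases lt_or_gt_of_ne hd0 with hd | hd
    · have hd' : (d : ℝ) ≤ -1 := by exact_mod_cast (by omega : d ≤ -1)
      have hneg : T α b + d < 0 := by linarith [(T_mem hα b).2, hα.2]
      refine hJ.out hb ha ⟨?_, ?_⟩
      · exact heb.symm.trans_le (one_div_le_one_div_of_neg_of_le hneg (by linarith))
      · exact (one_div_le_one_div_of_neg_of_le (by linarith) (by linarith)).trans_eq hea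
    · have hd' : (1 : ℝ) ≤ d := by exact_mod_cast (by omega : 1 ≤ d)
      have hpos : 0 < T α a + d := by linarith [(T_mem hα a).1, hα.1]
      refine hJ.out hb ha ⟨?_, ?_⟩
      · exact heb.symm.trans_le (one_div_le_one_div_of_le (by linarith) (by linarith))
      · exact (one_div_le_one_div_of_le hpos (by linarith)).trans_eq hea

lemma childImage_subset (hα : α ∈ Icc (1 / 2 : ℝ) 1) (J : Set ℝ) (d : ℤ) :
    childImage α J d ⊆ Ico (α - 1) α := by
  rintro _ ⟨u, _, rfl⟩
  exact T_mem hα u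

/-- At most two digits give pieces of an interval which are not mapped onto the domain. -/
lemma exists_two_digits (hα : α ∈ Icc (1 / 2 : ℝ) 1) {J : Set ℝ} (hJ : J.OrdConnected)
    (hJI : J ⊆ Ico (α - 1) α) :
    ∃ d e : ℤ, d ≠ e ∧ ∀ x ∈ J, x ≠ 0 → childImage α J (digit α 1 x) ≠ Ico (α - 1) α →
      digit α 1 x = d ∨ digit α 1 x = e := by
  by_contra! H
  obtain ⟨a, ha, ha0, hai, -, -⟩ := H 0 1 (by norm_num)
  obtain ⟨b, hb, hb0, hbi, hab, -⟩ := H (digit α 1 a) (digit α 1 a + 1) (by omega)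
  obtain ⟨c, hc, hc0, hci, hac, hbc⟩ := H (digit α 1 a) (digit α 1 b) hab.symm
  have key {x y z : ℝ} (hx : x ∈ J) (hy : y ∈ J) (hz : z ∈ J) (hy0 : y ≠ 0)
      (hdx : digit α 1 x ≠ digit α 1 y) (hdz : digit α 1 z ≠ digit α 1 y)
      (hyi : childImage α J (digit α 1 y) ≠ Ico (α - 1) α) (hxy : x < y) : z < y := by
    by_contra! h
    rcases h.lt_or_eq with h | h
    · exact hyi (childImage_eq_of_between hα hJ hJI hx hy hz hxy h hy0 hdx hdz)
    · exact hdz (by rw [h])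
  have hab' : a ≠ b := by rintro rfl; exact hab rfl
  have hac' : a ≠ c := by rintro rfl; exact hac rfl
  have hbc' : b ≠ c := by rintro rfl; exact hbc rfl
  rcases lt_or_gt_of_ne hab' with h1 | h1
  · have h2 := key ha hb hc hb0 hab.symm hbc hbi h1
    rcases lt_or_gt_of_ne hac' with h3 | h3
    · exact absurd (key ha hc hb hc0 hac.symm hbc.symm hci h3) h2.not_gt
    · exact absurd (key hc ha hb ha0 hac hab hai h3) h1.not_gt
  · have h2 := key hb ha hc ha0 hab hac hai h1
    rcases lt_or_gt_of_ne hbc' with h3 | h3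
    · exact absurd (key hb hc ha hc0 hbc.symm hac.symm hci h3) h2.not_gt
    · exact absurd (key hc hb ha hb0 hbc hab.symm hbi h3) h1.not_gt

lemma inter_cyl_one {J : Set ℝ} (hJI : J ⊆ Ico (α - 1) α) (x : ℝ) :
    J ∩ cyl α 1 x = {y | y ∈ J ∧ digit α 1 y = digit α 1 x} := by
  ext y
  constructor
  · rintro ⟨h1, -, h2⟩
    exact ⟨h1, (h2 0 one_pos).symm⟩
  · rintro ⟨h1, h2⟩
    refine ⟨h1, hJI h1, fun k hk => ?_⟩
    obtain rfl : k = 0 := by omega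
    exact h2.symm

lemma T_mem_nonFull (hα : α ∈ Icc (1 / 2 : ℝ) 1) {J : Set ℝ} (hJI : J ⊆ Ico (α - 1) α) {m : ℕ}
    {x : ℝ} (hx : x ∈ nonFull α (m + 1) J) :
    childImage α J (digit α 1 x) ≠ Ico (α - 1) α ∧
      T α x ∈ nonFull α m (childImage α J (digit α 1 x)) := by
  obtain ⟨hxJ, h⟩ := hx
  refine ⟨?_, ⟨x, ⟨hxJ, rfl⟩, rfl⟩, fun j hj hjm => ?_⟩
  · have := h 1 le_rfl (by omega)
    rwa [inter_cyl_one hJI, Function.iterate_one] at this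
  · intro heq
    refine h (j + 1) (by omega) (by omega) ?_
    rw [← heq, Function.iterate_succ, image_comp]
    congr 1
    ext t
    constructor
    · rintro ⟨y, ⟨hy, hy', hs⟩, rfl⟩
      rw [sameDigits_succ] at hs
      exact ⟨⟨y, ⟨hy, hs.1.symm⟩, rfl⟩, T_mem hα y, hs.2⟩
    · rintro ⟨⟨y, ⟨hy, hd⟩, rfl⟩, _, hs⟩
      exact ⟨y, ⟨hy, hJI hy, sameDigits_succ.2 ⟨hd.symm, hs⟩⟩, rfl⟩

end Structure

section Growth

variable {α : ℝ}

/-- The points of `J` with first digit `d` whose image lies in `B`. -/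
def piece (α : ℝ) (J : Set ℝ) (d : ℤ) (B : Set ℝ) : Set ℝ :=
  {x | x ∈ J ∧ digit α 1 x = d ∧ T α x ∈ B}

lemma image_piece_subset (J : Set ℝ) (d : ℤ) (B : Set ℝ) : T α '' piece α J d B ⊆ B := by
  rintro _ ⟨x, hx, rfl⟩
  exact hx.2.2

lemma exists_nonFull_subset (hα : α ∈ Icc (1 / 2 : ℝ) 1) {J : Set ℝ} (hJ : J.OrdConnected)
    (hJI : J ⊆ Ico (α - 1) α) (m : ℕ) (A : Set ℝ) :
    ∃ d e : ℤ, d ≠ e ∧ nonFull α (m + 1) J ∩ (T α)^[m + 1] ⁻¹' A ⊆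
      {0} ∪ (piece α J d (nonFull α m (childImage α J d) ∩ (T α)^[m] ⁻¹' A) ∪
        piece α J e (nonFull α m (childImage α J e) ∩ (T α)^[m] ⁻¹' A)) := by
  obtain ⟨d, e, hde, h⟩ := exists_two_digits hα hJ hJI
  refine ⟨d, e, hde, ?_⟩
  rintro x ⟨hx, hxA⟩
  by_cases hx0 : x = 0
  · exact Or.inl hx0
  · have h1 := T_mem_nonFull hα hJI hx
    rcases h x hx.1 hx0 h1.1 with hd | hd
    · rw [hd] at h1
      exact Or.inr (Or.inl ⟨hx.1, hd, h1.2, hxA⟩)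
    · rw [hd] at h1
      exact Or.inr (Or.inr ⟨hx.1, hd, h1.2, hxA⟩)

lemma volume_piece_le (hα : α ∈ Icc (1 / 2 : ℝ) 1) {J : Set ℝ} (hJI : J ⊆ Ico (α - 1) α)
    (d : ℤ) (B : Set ℝ) : volume (piece α J d B) ≤ volume B := by
  have := volume_le_of_antilipschitz (f := T α) (S := piece α J d B) zero_le_one
    fun x hx y hy => by
      rw [abs_sub_eq hα (hJI hx.1) (hJI hy.1) (hx.2.1.trans hy.2.1.symm)]
      refine mul_le_mul_of_nonneg_right ?_ (abs_nonneg _)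
      exact mul_le_one₀ (abs_le_one hα (hJI hx.1)) (abs_nonneg _) (abs_le_one hα (hJI hy.1))
  rw [ENNReal.ofReal_one, one_mul] at this
  exact this.trans (measure_mono (image_piece_subset J d B))

lemma volume_piece_le_of_ne_one (hα : α ∈ Icc (1 / 2 : ℝ) 1) {J : Set ℝ}
    (hJI : J ⊆ Ico (α - 1) α) {d : ℤ} (hd : d ≠ 1) (B : Set ℝ) :
    volume (piece α J d B) ≤ ENNReal.ofReal (4 / 9) * volume B := by
  have := volume_le_of_antilipschitz (f := T α) (S := piece α J d B) (c := 4 / 9) (by norm_num)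
    fun x hx y hy => by
      rw [abs_sub_eq hα (hJI hx.1) (hJI hy.1) (hx.2.1.trans hy.2.1.symm)]
      refine mul_le_mul_of_nonneg_right ?_ (abs_nonneg _)
      have h1 := abs_le_of_digit_ne_one hα (hJI hx.1) (hx.2.1 ▸ hd)
      have h2 := abs_le_of_digit_ne_one hα (hJI hy.1) (hy.2.1 ▸ hd)
      calc |x| * |y| ≤ 2 / 3 * (2 / 3) := mul_le_mul h1 h2 (abs_nonneg _) (by norm_num)
        _ = _ := by norm_num
  exact this.trans (by gcongr; exact image_piece_subset J d B)

lemma volume_piece_piece_le (hα : α ∈ Icc (1 / 2 : ℝ) 1) {J J' : Set ℝ}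
    (hJI : J ⊆ Ico (α - 1) α) (d : ℤ) (B : Set ℝ) :
    volume (piece α J 1 (piece α J' d B)) ≤ ENNReal.ofReal (1 / 4) * volume B := by
  have := volume_le_of_antilipschitz (f := (T α)^[2]) (S := piece α J 1 (piece α J' d B))
    (c := 1 / 4) (by norm_num) fun x hx y hy => by
      rw [abs_sub_eq hα (hJI hx.1) (hJI hy.1) (hx.2.1.trans hy.2.1.symm),
        abs_sub_eq hα (T_mem hα x) (T_mem hα y) (hx.2.2.2.1.trans hy.2.2.2.1.symm)]
      have h1 := abs_mul_abs_T_le_of_digit_eq_one hα (hJI hx.1) hx.2.1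
      have h2 := abs_mul_abs_T_le_of_digit_eq_one hα (hJI hy.1) hy.2.1
      calc |x| * |y| * (|T α x| * |T α y| * |T α (T α x) - T α (T α y)|)
          = |x| * |T α x| * (|y| * |T α y|) * |T α (T α x) - T α (T α y)| := by ring
        _ ≤ 1 / 2 * (1 / 2) * |T α (T α x) - T α (T α y)| := by gcongr
        _ = _ := by norm_num
  refine this.trans ?_
  gcongr
  rintro _ ⟨x, hx, rfl⟩
  exact hx.2.2.2.2

lemma piece_union_subset (J : Set ℝ) (d : ℤ) (B C D : Set ℝ) :
    piece α J d (B ∪ (C ∪ D)) ⊆ piece α J d B ∪ (piece α J d C ∪ piece α J d D) := by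
  rintro x ⟨h1, h2, h3 | h3 | h3⟩
  · exact Or.inl ⟨h1, h2, h3⟩
  · exact Or.inr (Or.inl ⟨h1, h2, h3⟩)
  · exact Or.inr (Or.inr ⟨h1, h2, h3⟩)

lemma volume_nonFull_inter_preimage_le (hα : α ∈ Icc (1 / 2 : ℝ) 1) (m : ℕ) (A : Set ℝ)
    {J : Set ℝ} (hJ : J.OrdConnected) (hJI : J ⊆ Ico (α - 1) α) :
    volume (nonFull α m J ∩ (T α)^[m] ⁻¹' A) ≤
      ENNReal.ofReal (3 * (49 / 50) ^ m) * volume A := by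
  induction m using Nat.twoStepInduction generalizing J with
  | zero =>
    calc volume (nonFull α 0 J ∩ (T α)^[0] ⁻¹' A) ≤ 1 * volume A := by
          rw [one_mul]; exact measure_mono inter_subset_right
      _ ≤ _ := by
          gcongr
          rw [ENNReal.one_le_ofReal]; norm_num
  | one =>
    obtain ⟨d, e, -, h⟩ := exists_nonFull_subset hα hJ hJI 0 A
    have hle (d : ℤ) :
        volume (piece α J d (nonFull α 0 (childImage α J d) ∩ (T α)^[0] ⁻¹' A)) ≤ volume A :=
      (volume_piece_le hα hJI d _).trans (measure_mono inter_subset_right)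
    calc volume (nonFull α 1 J ∩ (T α)^[1] ⁻¹' A)
        ≤ volume {(0 : ℝ)} + (volume A + volume A) :=
          (measure_mono h).trans ((measure_union_le _ _).trans
            (add_le_add le_rfl ((measure_union_le _ _).trans (add_le_add (hle d) (hle e)))))
      _ = 2 * volume A := by rw [Real.volume_singleton, zero_add, two_mul]
      _ ≤ _ := by
          gcongr
          rw [← ENNReal.ofReal_ofNat]
          exact ENNReal.ofReal_le_ofReal (by norm_num)
  | more m ih ih' =>
    obtain ⟨d, e, hde, h⟩ := exists_nonFull_subset hα hJ hJI (m + 1) A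
    have hne {d : ℤ} (hd : d ≠ 1) :
        volume (piece α J d (nonFull α (m + 1) (childImage α J d) ∩ (T α)^[m + 1] ⁻¹' A)) ≤
          ENNReal.ofReal (4 / 9 * (3 * (49 / 50) ^ (m + 1))) * volume A := by
      refine (volume_piece_le_of_ne_one hα hJI hd _).trans ?_
      rw [ENNReal.ofReal_mul (by norm_num), mul_assoc]
      gcongr
      exact ih' (ordConnected_childImage hα hJ hJI d) (childImage_subset hα J d)
    have hone :
        volume (piece α J 1 (nonFull α (m + 1) (childImage α J 1) ∩ (T α)^[m + 1] ⁻¹' A)) ≤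
          ENNReal.ofReal (1 / 2 * (3 * (49 / 50) ^ m)) * volume A := by
      have hK := ordConnected_childImage hα hJ hJI 1
      have hKI := childImage_subset hα J 1
      obtain ⟨d', e', -, h'⟩ := exists_nonFull_subset hα hK hKI m A
      set K := childImage α J 1
      have hle (d' : ℤ) :
          volume (piece α J 1 (piece α K d'
            (nonFull α m (childImage α K d') ∩ (T α)^[m] ⁻¹' A))) ≤
            ENNReal.ofReal (1 / 4 * (3 * (49 / 50) ^ m)) * volume A := by
        refine (volume_piece_piece_le hα hJI d' _).trans ?_
        rw [ENNReal.ofReal_mul (p := 1 / 4) (by norm_num), mul_assoc]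
        gcongr
        exact ih (ordConnected_childImage hα hK hKI d') (childImage_subset hα K d')
      have hmono : piece α J 1 (nonFull α (m + 1) K ∩ (T α)^[m + 1] ⁻¹' A) ⊆ _ :=
        fun x hx => piece_union_subset J 1 _ _ _ ⟨hx.1, hx.2.1, h' hx.2.2⟩
      have hzero : volume (piece α J 1 {0}) ≤ 0 :=
        (volume_piece_le hα hJI 1 _).trans_eq Real.volume_singleton
      refine ((measure_mono hmono).trans ((measure_union_le _ _).trans (add_le_add hzero
        ((measure_union_le _ _).trans (add_le_add (hle d') (hle e')))))).trans_eq ?_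
      rw [zero_add, ← add_mul, ← ENNReal.ofReal_add (by positivity) (by positivity)]
      congr 2
      ring
    have htwo {p q : ℝ} (hp : 0 ≤ p) (hq : 0 ≤ q) (hpq : p + q ≤ 3 * (49 / 50) ^ (m + 2))
        (hd : volume (piece α J d (nonFull α (m + 1) (childImage α J d) ∩
          (T α)^[m + 1] ⁻¹' A)) ≤ ENNReal.ofReal p * volume A)
        (he : volume (piece α J e (nonFull α (m + 1) (childImage α J e) ∩
          (T α)^[m + 1] ⁻¹' A)) ≤ ENNReal.ofReal q * volume A) :
        volume (nonFull α (m + 2) J ∩ (T α)^[m + 2] ⁻¹' A) ≤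
          ENNReal.ofReal (3 * (49 / 50) ^ (m + 2)) * volume A := by
      refine ((measure_mono h).trans ((measure_union_le _ _).trans (add_le_add
        Real.volume_singleton.le ((measure_union_le _ _).trans (add_le_add hd he))))).trans ?_
      rw [zero_add, ← add_mul, ← ENNReal.ofReal_add hp hq]
      gcongr
    have hpos : (0 : ℝ) < (49 / 50) ^ m := by positivity
    by_cases hd1 : d = 1
    · subst hd1
      refine htwo (by positivity) (by positivity) ?_ hone (hne hde.symm)
      rw [pow_add, pow_add]
      linarith
    · by_cases he1 : e = 1
      · subst he1
        refine htwo (by positivity) (by positivity) ?_ (hne hde) hone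
        rw [pow_add, pow_add]
        linarith
      · refine htwo (by positivity) (by positivity) ?_ (hne hd1) (hne he1)
        rw [pow_add, pow_add]
        linarith

lemma mem_fullSet_zero {x : ℝ} (hx : x ∈ Ico (α - 1) α) : x ∈ fullSet α 0 := by
  refine ⟨hx, ?_⟩
  rw [Function.iterate_zero, image_id]
  exact Subset.antisymm (fun y hy => hy.1) fun y hy => ⟨hy, fun k hk => absurd hk (by omega)⟩

lemma mem_fullSet_add (hα : α ∈ Icc (1 / 2 : ℝ) 1) {k j : ℕ} {x : ℝ} (hx : x ∈ fullSet α k)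
    (h : (T α)^[j] '' (Ico (α - 1) α ∩ cyl α j ((T α)^[k] x)) = Ico (α - 1) α) :
    x ∈ fullSet α (k + j) := by
  refine ⟨hx.1, Subset.antisymm ?_ fun t ht => ?_⟩
  · rintro _ ⟨y, hy, rfl⟩
    exact iterate_mem hα hy.1 _
  · rw [← h] at ht
    obtain ⟨y, ⟨hy, hyc⟩, rfl⟩ := ht
    rw [← hx.2] at hy
    obtain ⟨z, hz, rfl⟩ := hy
    refine ⟨z, ⟨hz.1, sameDigits_add.2 ⟨hz.2, hyc.2⟩⟩, ?_⟩
    rw [add_comm, Function.iterate_add_apply]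

lemma iterate_mem_nonFull (hα : α ∈ Icc (1 / 2 : ℝ) 1) {k m : ℕ} {x : ℝ} (hx : x ∈ fullSet α k)
    (h : ∀ n, k < n → n ≤ k + m → x ∉ fullSet α n) :
    (T α)^[k] x ∈ nonFull α m (Ico (α - 1) α) :=
  ⟨iterate_mem hα hx.1 k, fun j hj hjm heq =>
    h (k + j) (by omega) (by omega) (mem_fullSet_add hα hx heq)⟩

lemma volume_preimage_le (hα : α ∈ Icc (1 / 2 : ℝ) 1) (n : ℕ) (A : Set ℝ) :
    volume ((T α)^[n] ⁻¹' A ∩ Ico (α - 1) α) ≤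
      ENNReal.ofReal (Real.exp 15 ^ 4 * 150) * volume A := by
  have hsub : (T α)^[n] ⁻¹' A ∩ Ico (α - 1) α ⊆ ⋃ m ∈ Finset.range (n + 1),
      fullSet α (n - m) ∩ (T α)^[n - m] ⁻¹' (nonFull α m (Ico (α - 1) α) ∩ (T α)^[m] ⁻¹' A) := by
    rintro x ⟨hxA, hx⟩
    classical
    set k := Nat.findGreatest (fun k => x ∈ fullSet α k) n
    have hkn : k ≤ n := Nat.findGreatest_le n
    have hk : x ∈ fullSet α k :=
      Nat.findGreatest_spec (P := fun k => x ∈ fullSet α k) zero_le (mem_fullSet_zero hx)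
    simp only [mem_iUnion, Finset.mem_range]
    refine ⟨n - k, by omega, ?_⟩
    rw [Nat.sub_sub_self hkn]
    refine ⟨hk, iterate_mem_nonFull hα hk fun i hi hin => ?_, ?_⟩
    · exact Nat.findGreatest_is_greatest hi (by omega)
    · rw [mem_preimage, ← Function.iterate_add_apply, Nat.sub_add_cancel hkn]
      exact hxA
  have hgeom : ∑ m ∈ Finset.range (n + 1), (3 * (49 / 50) ^ m : ℝ) ≤ 150 := by
    rw [← Finset.mul_sum]
    have h1 := (summable_geometric_of_lt_one (r := (49 / 50 : ℝ)) (by norm_num)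
      (by norm_num)).sum_le_tsum (Finset.range (n + 1)) fun i _ => by positivity
    rw [tsum_geometric_of_lt_one (by norm_num) (by norm_num)] at h1
    norm_num at h1
    linarith
  calc volume ((T α)^[n] ⁻¹' A ∩ Ico (α - 1) α)
      ≤ ∑ m ∈ Finset.range (n + 1), volume (fullSet α (n - m) ∩
          (T α)^[n - m] ⁻¹' (nonFull α m (Ico (α - 1) α) ∩ (T α)^[m] ⁻¹' A)) :=
        (measure_mono hsub).trans (measure_biUnion_finset_le _ _)
    _ ≤ ∑ m ∈ Finset.range (n + 1), ENNReal.ofReal (Real.exp 15 ^ 4) *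
          (ENNReal.ofReal (3 * (49 / 50) ^ m) * volume A) := by
        gcongr with m _
        refine (volume_fullSet_inter_preimage_le hα _ _).trans ?_
        gcongr
        exact volume_nonFull_inter_preimage_le hα m A ordConnected_Ico Subset.rfl
    _ = ENNReal.ofReal (Real.exp 15 ^ 4 * ∑ m ∈ Finset.range (n + 1), 3 * (49 / 50) ^ m) *
          volume A := by
        rw [← Finset.mul_sum, ← Finset.sum_mul, ← ENNReal.ofReal_sum_of_nonneg
          (fun _ _ => by positivity), ← mul_assoc, ← ENNReal.ofReal_mul (by positivity)]
    _ ≤ _ := by gcongr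

lemma ae_frequently_mem_fullSet (hα : α ∈ Icc (1 / 2 : ℝ) 1) :
    ∀ᵐ x, x ∈ Ico (α - 1) α → ∃ᶠ n in Filter.atTop, x ∈ fullSet α n := by
  have hnull : volume (⋂ m, nonFull α m (Ico (α - 1) α)) = 0 := by
    have hlim : Filter.Tendsto (fun m : ℕ => ENNReal.ofReal (3 * (49 / 50) ^ m)) Filter.atTop
        (nhds 0) := by
      rw [← ENNReal.ofReal_zero]
      refine (ENNReal.continuous_ofReal.tendsto 0).comp ?_
      simpa using (tendsto_pow_atTop_nhds_zero_of_lt_one (r := (49 / 50 : ℝ)) (by norm_num)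
        (by norm_num)).const_mul 3
    refine le_antisymm (ge_of_tendsto' hlim fun m => ?_) zero_le
    have := volume_nonFull_inter_preimage_le hα m (Ico (α - 1) α) ordConnected_Ico Subset.rfl
    rw [volume_domain, mul_one] at this
    refine (measure_mono fun x hx => ?_).trans this
    have hx' := mem_iInter.1 hx m
    exact ⟨hx', iterate_mem hα hx'.1 m⟩
  have hall : ∀ᵐ x, ∀ k, x ∉ fullSet α k ∩ (T α)^[k] ⁻¹' ⋂ m, nonFull α m (Ico (α - 1) α) := by
    refine ae_all_iff.2 fun k => measure_eq_zero_iff_ae_notMem.1 (le_antisymm ?_ zero_le)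
    refine (volume_fullSet_inter_preimage_le hα k _).trans_eq ?_
    rw [hnull, mul_zero]
  filter_upwards [hall] with x hx hxI
  by_contra hfreq
  rw [Filter.not_frequently, Filter.eventually_atTop] at hfreq
  obtain ⟨N, hN⟩ := hfreq
  classical
  set k := Nat.findGreatest (fun k => x ∈ fullSet α k) N
  have hk : x ∈ fullSet α k :=
    Nat.findGreatest_spec (P := fun k => x ∈ fullSet α k) zero_le (mem_fullSet_zero hxI)
  refine hx k ⟨hk, mem_iInter.2 fun m => iterate_mem_nonFull hα hk fun n hn _ => ?_⟩
  rcases le_total n N with h | h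
  · exact Nat.findGreatest_is_greatest hn h
  · exact hN n h

end Growth

section InvariantMeasure

/-- Krylov–Bogolyubov for a quasi-invariant measure: if the push-forwards of `μ` under the
iterates of `f` are uniformly dominated by `μ`, then `f` has an invariant probability measure
which is absolutely continuous with respect to `μ`. -/
lemma exists_measurePreserving_of_measure_preimage_le {X : Type*} [MeasurableSpace X]
    (μ : Measure X) [IsProbabilityMeasure μ] {f : X → X} (hf : Measurable f) {C : ENNReal}
    (hC : C ≠ ⊤) (h : ∀ n A, MeasurableSet A → μ (f^[n] ⁻¹' A) ≤ C * μ A) :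
    ∃ ν : Measure X, IsProbabilityMeasure ν ∧ MeasurePreserving f ν ν ∧ ν ≪ μ := by
  let U : Ultrafilter ℕ := Filter.hyperfilter ℕ
  have hU : (U : Filter ℕ) ≤ Filter.atTop := Nat.hyperfilter_le_atTop
  let a (A : Set X) (n : ℕ) : ENNReal := (∑ k ∈ Finset.range n, μ (f^[k] ⁻¹' A)) / n
  have hlim (A : Set X) : ∃ l, Filter.Tendsto (a A) U (nhds l) :=
    ⟨(U.map (a A)).lim, (U.map (a A)).le_nhds_lim⟩
  choose m hm using hlim
  have hpos : ∀ᶠ n : ℕ in U, 0 < n := hU (Filter.eventually_gt_atTop 0)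
  have hmC (A : Set X) (hA : MeasurableSet A) : m A ≤ C * μ A := by
    refine le_of_tendsto (hm A) (hpos.mono fun n _ => ?_)
    refine ENNReal.div_le_of_le_mul' ?_
    calc ∑ k ∈ Finset.range n, μ (f^[k] ⁻¹' A) ≤ ∑ k ∈ Finset.range n, C * μ A :=
          Finset.sum_le_sum fun k _ => h k A hA
      _ = n * (C * μ A) := by simp
  have hadd (A B : Set X) (hB : MeasurableSet B) (hd : Disjoint A B) :
      m (A ∪ B) = m A + m B := by
    refine tendsto_nhds_unique (hm _) (((hm A).add (hm B)).congr fun n => ?_)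
    simp only [a]
    rw [← ENNReal.add_div, ← Finset.sum_add_distrib]
    congr 1
    refine Finset.sum_congr rfl fun k _ => ?_
    rw [preimage_union, measure_union (hd.preimage _) ((hf.iterate k) hB)]
  have hempty : m ∅ = 0 := le_antisymm ((hmC ∅ MeasurableSet.empty).trans (by simp)) zero_le
  have huniv : m univ = 1 := by
    refine tendsto_nhds_unique (hm _) (tendsto_const_nhds.congr' (hpos.mono fun n hn => ?_))
    simp only [a, preimage_univ, measure_univ, Finset.sum_const, Finset.card_range, nsmul_eq_mul,
      mul_one]
    rw [ENNReal.div_self (by simpa using hn.ne') (ENNReal.natCast_ne_top n)]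
  have hinv (A : Set X) : m (f ⁻¹' A) = m A := by
    have hz : Filter.Tendsto (fun n : ℕ => (1 : ENNReal) / n) U (nhds 0) := by
      simpa using ENNReal.tendsto_inv_nat_nhds_zero.mono_left hU
    have hshift (n : ℕ) : ∑ k ∈ Finset.range n, μ (f^[k] ⁻¹' (f ⁻¹' A)) + μ A =
        ∑ k ∈ Finset.range n, μ (f^[k] ⁻¹' A) + μ (f^[n] ⁻¹' A) := by
      rw [← Finset.sum_range_succ, Finset.sum_range_succ', Function.iterate_zero, preimage_id]
      congr 1
      refine Finset.sum_congr rfl fun k _ => ?_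
      rw [Function.iterate_succ', preimage_comp]
    apply le_antisymm
    · refine le_of_tendsto_of_tendsto' (hm (f ⁻¹' A)) (by simpa only [add_zero] using (hm A).add hz) fun n => ?_
      simp only [a]
      rw [← ENNReal.add_div]
      gcongr
      calc _ ≤ ∑ k ∈ Finset.range n, μ (f^[k] ⁻¹' (f ⁻¹' A)) + μ A := le_self_add
        _ ≤ _ := by rw [hshift]; gcongr; exact prob_le_one
    · refine le_of_tendsto_of_tendsto' (hm A) (by simpa only [add_zero] using (hm (f ⁻¹' A)).add hz) fun n => ?_
      simp only [a]
      rw [← ENNReal.add_div]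
      gcongr
      calc _ ≤ ∑ k ∈ Finset.range n, μ (f^[k] ⁻¹' A) + μ (f^[n] ⁻¹' A) := le_self_add
        _ ≤ _ := by rw [← hshift]; gcongr; exact prob_le_one
  have hfin (F : ℕ → Set X) (hF : ∀ i, MeasurableSet (F i)) (hd : Pairwise (Function.onFun Disjoint F))
      (n : ℕ) : m (⋃ i, F i) = ∑ i ∈ Finset.range n, m (F i) + m (⋃ i, F (i + n)) := by
    induction n with
    | zero => simp
    | succ n ih =>
      have hsplit : ⋃ i, F (i + n) = F n ∪ ⋃ i, F (i + (n + 1)) := by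
        rw [← union_iUnion_nat_succ, zero_add]
        simp only [add_assoc, add_comm 1]
      rw [ih, Finset.sum_range_succ, add_assoc, hsplit, hadd _ _ (MeasurableSet.iUnion fun i => hF _)]
      exact disjoint_iUnion_right.2 fun i => hd (by omega)
  have hsigma (F : ℕ → Set X) (hF : ∀ i, MeasurableSet (F i)) (hd : Pairwise (Function.onFun Disjoint F)) :
      m (⋃ i, F i) = ∑' i, m (F i) := by
    have htail : Filter.Tendsto (fun n => m (⋃ i, F (i + n))) Filter.atTop (nhds 0) := by
      have hμ : Filter.Tendsto (fun n => C * ∑' i, μ (F (i + n))) Filter.atTop (nhds 0) := by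
        have hs : ∑' i, μ (F i) ≠ ⊤ := by
          rw [← measure_iUnion hd hF]; exact measure_ne_top _ _
        simpa using ENNReal.Tendsto.const_mul (ENNReal.tendsto_sum_nat_add _ hs) (Or.inr hC)
      refine tendsto_of_tendsto_of_tendsto_of_le_of_le tendsto_const_nhds hμ (fun _ => zero_le)
        fun n => (hmC _ (MeasurableSet.iUnion fun i => hF _)).trans ?_
      gcongr
      exact measure_iUnion_le _
    refine tendsto_nhds_unique (l := (Filter.atTop : Filter ℕ)) tendsto_const_nhds
      (Filter.Tendsto.congr (fun n => (hfin F hF hd n).symm) ?_)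
    simpa using (ENNReal.tendsto_nat_tsum fun i => m (F i)).add htail
  let ν : Measure X := Measure.ofMeasurable (fun A _ => m A) hempty hsigma
  have hν (A : Set X) (hA : MeasurableSet A) : ν A = m A := Measure.ofMeasurable_apply A hA
  refine ⟨ν, ⟨by rw [hν _ MeasurableSet.univ, huniv]⟩, ⟨hf, ?_⟩, ?_⟩
  · ext A hA
    rw [Measure.map_apply hf hA, hν _ (hf hA), hν A hA, hinv]
  · refine Measure.AbsolutelyContinuous.mk fun A hA h0 => ?_
    rw [hν A hA]
    refine le_antisymm ((hmC A hA).trans ?_) zero_le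
    rw [h0, mul_zero]

end InvariantMeasure

section ForwardInvariant

variable {α : ℝ}

lemma volume_domain_diff_le (hα : α ∈ Icc (1 / 2 : ℝ) 1) {S : Set ℝ} (hS : S ⊆ T α ⁻¹' S) {n : ℕ}
    {x : ℝ} (hx : x ∈ fullSet α n) :
    volume (Ico (α - 1) α \ S) ≤ ENNReal.ofReal ((Real.exp 15 / weight α n x) ^ 2) *
      volume (Sᶜ ∩ Metric.closedBall x ((Real.exp 15 * weight α n x) ^ 2)) := by
  have hSn : S ⊆ (T α)^[n] ⁻¹' S := (show MapsTo (T α) S S from hS).iterate n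
  calc volume (Ico (α - 1) α \ S) ≤ volume ((T α)^[n] '' (cyl α n x \ S)) := by
        refine measure_mono fun t ht => ?_
        have ht' := ht.1
        rw [← hx.2] at ht'
        obtain ⟨y, hy, rfl⟩ := ht'
        exact ⟨y, ⟨hy, fun hyS => ht.2 (hSn hyS)⟩, rfl⟩
    _ ≤ _ * volume (cyl α n x \ S) := volume_image_le_weight hα hx sdiff_subset
    _ ≤ _ := by
        gcongr
        rintro y ⟨hy, hyS⟩
        refine ⟨hyS, ?_⟩
        rw [Metric.mem_closedBall, Real.dist_eq, abs_sub_comm,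
          abs_sub_eq_weight hα n hx.1 hy.1 hy.2]
        have hw := weight_nonneg (α := α) n x
        have h1 := weight_le_mul hα n hy.1 hx.1 hy.2.symm
        have h2 : weight α n x ≤ Real.exp 15 * weight α n x :=
          le_mul_of_one_le_left hw (Real.one_le_exp (by norm_num))
        calc _ ≤ Real.exp 15 * weight α n x * (Real.exp 15 * weight α n x) * 1 := by
              gcongr
              · exact weight_nonneg n y
              · exact abs_sub_le_one (iterate_mem hα hx.1 n) (iterate_mem hα hy.1 n)
          _ = _ := by ring

/-- A forward invariant set is either null or of full measure in the domain. -/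
lemma volume_diff_eq_zero_of_forward_invariant (hα : α ∈ Icc (1 / 2 : ℝ) 1) {S : Set ℝ}
    (hSm : MeasurableSet S) (hS : S ⊆ T α ⁻¹' S) (h0 : volume (S ∩ Ico (α - 1) α) ≠ 0) :
    volume (Ico (α - 1) α \ S) = 0 := by
  obtain ⟨x, ⟨hxS, hxI⟩, hfreq, hdens⟩ : ∃ x ∈ S ∩ Ico (α - 1) α,
      (x ∈ Ico (α - 1) α → ∃ᶠ n in Filter.atTop, x ∈ fullSet α n) ∧
      Filter.Tendsto (fun r => volume (Sᶜ ∩ Metric.closedBall x r) / volume (Metric.closedBall x r))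
        (nhdsWithin 0 (Ioi 0)) (nhds (Sᶜ.indicator 1 x)) := by
    by_contra! H
    refine h0 (measure_eq_zero_iff_ae_notMem.2 ?_)
    filter_upwards [ae_frequently_mem_fullSet hα,
      Besicovitch.ae_tendsto_measure_inter_div_of_measurableSet volume hSm.compl] with x h1 h2 hx
    exact H x hx h1 h2
  rw [indicator_of_notMem (by simpa using hxS)] at hdens
  have hr : Filter.Tendsto (fun n => (Real.exp 15 * weight α n x) ^ 2) Filter.atTop (nhds 0) := by
    have hw : Filter.Tendsto (fun n => weight α n x) Filter.atTop (nhds 0) := by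
      refine squeeze_zero (fun n => weight_nonneg n x) (fun n => weight_le hα n hxI) ?_
      simpa using (tendsto_pow_atTop_nhds_zero_of_lt_one (r := (9 / 10 : ℝ)) (by norm_num)
        (by norm_num)).const_mul (3 / 2)
    simpa using (hw.const_mul (Real.exp 15)).pow 2
  have hbound (ε : ENNReal) (hε : 0 < ε) :
      volume (Ico (α - 1) α \ S) ≤ ENNReal.ofReal (2 * Real.exp 15 ^ 4) * ε := by
    have h1 := hdens.eventually (gt_mem_nhds hε)
    rw [eventually_nhdsWithin_iff] at h1
    obtain ⟨n, hn, h2⟩ := ((hfreq hxI).and_eventually (hr.eventually h1)).exists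
    have hw := weight_pos_of_mem_fullSet hα hn
    have hrpos : 0 < (Real.exp 15 * weight α n x) ^ 2 := by positivity
    have h3 := (h2 hrpos).le
    rw [Real.volume_closedBall, ENNReal.div_le_iff (by simpa using hw.ne') ENNReal.ofReal_ne_top]
      at h3
    refine (volume_domain_diff_le hα hS hn).trans ?_
    calc _ ≤ ENNReal.ofReal ((Real.exp 15 / weight α n x) ^ 2) *
          (ε * ENNReal.ofReal (2 * (Real.exp 15 * weight α n x) ^ 2)) := by gcongr
      _ = _ := by
        rw [mul_comm ε, ← mul_assoc, ← ENNReal.ofReal_mul (by positivity)]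
        congr 2
        field_simp
  have hlim : Filter.Tendsto (fun ε : ENNReal => ENNReal.ofReal (2 * Real.exp 15 ^ 4) * ε)
      (nhdsWithin 0 (Ioi 0)) (nhds 0) := by
    have := ENNReal.Tendsto.const_mul (a := ENNReal.ofReal (2 * Real.exp 15 ^ 4))
      (Filter.tendsto_id (α := ENNReal) (x := nhds 0)) (Or.inr ENNReal.ofReal_ne_top)
    rw [mul_zero] at this
    exact this.mono_left nhdsWithin_le_nhds
  exact le_antisymm (ge_of_tendsto hlim (eventually_mem_nhdsWithin.mono hbound)) zero_le

end ForwardInvariant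

/-- For every α ∈ [1/2, 1] there exists a Borel probability measure μ_α on [α−1, α)
that is invariant under T_α, ergodic for T_α, and equivalent to Lebesgue measure
(restricted to [α−1, α)). -/
theorem exists_ergodic_invariant_measure (α : ℝ) (hα : α ∈ Set.Icc (1 / 2 : ℝ) 1) :
    ∃ μ : Measure ℝ, IsProbabilityMeasure μ ∧
      Ergodic (T α) μ ∧
      μ ≪ volume.restrict (Set.Ico (α - 1) α) ∧
      volume.restrict (Set.Ico (α - 1) α) ≪ μ := by
  set I := Ico (α - 1) α with hI
  have : IsProbabilityMeasure (volume.restrict I) :=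
    ⟨by rw [Measure.restrict_apply_univ, volume_domain]⟩
  obtain ⟨ν, hν, hpres, hac⟩ := exists_measurePreserving_of_measure_preimage_le
    (volume.restrict I) (measurable_T (α := α)) (C := ENNReal.ofReal (Real.exp 15 ^ 4 * 150))
    ENNReal.ofReal_ne_top fun n A hA => by
      rw [Measure.restrict_apply ((measurable_T.iterate n) hA), Measure.restrict_apply hA]
      refine (measure_mono ?_).trans (volume_preimage_le hα n (A ∩ I))
      rintro x ⟨hxA, hx⟩
      exact ⟨⟨hxA, iterate_mem hα hx n⟩, hx⟩
  have hfull {S : Set ℝ} (hSm : MeasurableSet S) (hS : S ⊆ T α ⁻¹' S) :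
      volume.restrict I S = 0 ∨ volume.restrict I Sᶜ = 0 := by
    rw [or_iff_not_imp_left, Measure.restrict_apply hSm, Measure.restrict_apply hSm.compl,
      inter_comm Sᶜ, ← sdiff_eq]
    exact volume_diff_eq_zero_of_forward_invariant hα hSm hS
  refine ⟨ν, hν, ⟨hpres, ⟨fun {s} hs hinv => ?_⟩⟩, hac, ?_⟩
  · rw [Filter.eventuallyConst_set']
    rcases hfull hs hinv.ge with h | h
    · exact Or.inl (ae_eq_empty.2 (hac h))
    · exact Or.inr (ae_eq_univ.2 (hac h))
  · refine Measure.AbsolutelyContinuous.mk fun A hA h0 => ?_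
    have hB : ν (⋃ n, (T α)^[n] ⁻¹' A) = 0 :=
      measure_iUnion_null fun n => by
        rw [(hpres.iterate n).measure_preimage hA.nullMeasurableSet, h0]
    have hBm : MeasurableSet (⋃ n, (T α)^[n] ⁻¹' A) :=
      MeasurableSet.iUnion fun n => (measurable_T.iterate n) hA
    have hfwd : (⋃ n, (T α)^[n] ⁻¹' A)ᶜ ⊆ T α ⁻¹' (⋃ n, (T α)^[n] ⁻¹' A)ᶜ := by
      intro x hx hx'
      obtain ⟨n, hn⟩ := mem_iUnion.1 hx'
      exact hx (mem_iUnion.2 ⟨n + 1, hn⟩)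
    rcases hfull hBm.compl hfwd with h | h
    · have h1 : ν univ ≤ 0 + 0 := by
        rw [← union_compl_self (⋃ n, (T α)^[n] ⁻¹' A)]
        exact (measure_union_le _ _).trans (add_le_add hB.le (hac h).le)
      rw [measure_univ] at h1
      exact absurd h1 (by simp)
    · rw [compl_compl] at h
      exact measure_mono_null (fun x hx => mem_iUnion.2 ⟨0, hx⟩) h
end

section
/- For α ∈ [1/2, 1] and every cylinder set ⟨a_1, …, a_n⟩ with n ≥ 1, the Lebesgue measure satisfies λ(⟨a_1, …, a_n⟩) ≤ g^{2(n−1)} / 2. -/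
open MeasureTheory Set

theorem g_sq : g ^ 2 = 1 - g := by
  have h := Real.sq_sqrt (show (0 : ℝ) ≤ 5 by norm_num)
  unfold g
  linear_combination h / 4

theorem g_gt : 0.618 < g := by
  have h : (2.236 : ℝ) < √5 := Real.lt_sqrt_of_sq_lt (by norm_num)
  unfold g
  linarith

theorem g_lt : g < 0.6181 := by
  have h : √5 < (2.2362 : ℝ) := (Real.sqrt_lt' (by norm_num)).2 (by norm_num)
  unfold g
  linarith

/-- `x` is a nonzero point of the domain whose first digit is `b`. -/
structure HasFirstDigit (α x : ℝ) (b : ℤ) : Prop where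
  mem : x ∈ Ico (α - 1) α
  ne_zero : x ≠ 0
  mul_T : x * T α x = 1 - b * x
  T_mem : T α x ∈ Ico (α - 1) α

theorem digit_T (α x : ℝ) {k : ℕ} (hk : 1 ≤ k) : digit α k (T α x) = digit α (k + 1) x := by
  obtain ⟨k, rfl⟩ := Nat.exists_eq_add_of_le' hk
  simp [digit, Function.iterate_succ_apply]

theorem HasFirstDigit.of_mem_cylinder {α x : ℝ} {n : ℕ} {a : ℕ → ℤ} (hn : 1 ≤ n)
    (ha : a 1 ≠ 0) (hx : x ∈ cylinder α n a) : HasFirstDigit α x (a 1) := by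
  have hd := hx.2 1 le_rfl hn
  have hx0 : x ≠ 0 := by
    rintro rfl
    simp [digit] at hd
    exact ha hd.symm
  simp only [digit, Nat.sub_self, Function.iterate_zero, id_eq, if_neg hx0] at hd
  have hT : T α x = 1 / x - (a 1 : ℝ) := by simp only [T, if_neg hx0, hd]
  have h1 := Int.floor_le (1 / x + 1 - α)
  have h2 := Int.lt_floor_add_one (1 / x + 1 - α)
  rw [hd] at h1 h2
  refine ⟨hx.1, hx0, ?_, ?_, ?_⟩
  · rw [hT]
    field_simp
  · rw [hT]
    linarith
  · rw [hT]
    linarith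

theorem T_mem_cylinder {α x : ℝ} {n : ℕ} {a : ℕ → ℤ} (ha : a 1 ≠ 0)
    (hx : x ∈ cylinder α (n + 1) a) : T α x ∈ cylinder α n (fun k => a (k + 1)) :=
  ⟨(HasFirstDigit.of_mem_cylinder (by omega) ha hx).T_mem, fun k hk hkn => by
    rw [digit_T α x hk, hx.2 (k + 1) (by omega) (by omega)]⟩

namespace HasFirstDigit

variable {α x y : ℝ} {b : ℤ}

theorem abs_sub_eq (hx : HasFirstDigit α x b) (hy : HasFirstDigit α y b) :
    |x - y| = |x| * |y| * |T α x - T α y| := by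
  rw [abs_sub_comm x y, ← abs_mul, ← abs_mul]
  congr 1
  linear_combination (-y) * hx.mul_T + x * hy.mul_T

theorem abs_T_sub_le_one (hx : HasFirstDigit α x b) (hy : HasFirstDigit α y b) :
    |T α x - T α y| ≤ 1 := by
  obtain ⟨h1, h2⟩ := hx.T_mem
  obtain ⟨h3, h4⟩ := hy.T_mem
  rw [abs_le]
  constructor <;> linarith

theorem digit_pos (hx : HasFirstDigit α x b) (h1 : α ≤ 1) (h : 0 < x) : 1 ≤ b := by
  by_contra! hb
  have hb' : (b : ℝ) ≤ 0 := by exact_mod_cast Int.lt_add_one_iff.mp hb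
  have := hx.mul_T
  have hxα := hx.mem.2
  have hT := hx.T_mem.2
  nlinarith

theorem digit_neg (hx : HasFirstDigit α x b) (h0 : 1 / 2 ≤ α) (h : x < 0) : b ≤ -1 := by
  by_contra! hb
  have hb' : (0 : ℝ) ≤ b := by exact_mod_cast (show 0 ≤ b by omega)
  have := hx.mul_T
  have hxα := hx.mem.1
  have hT := hx.T_mem.1
  nlinarith

theorem pos (hx : HasFirstDigit α x b) (h0 : 1 / 2 ≤ α) (hb : 0 < b) : 0 < x := by
  rcases lt_trichotomy x 0 with h | h | h
  · have := hx.digit_neg h0 h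
    omega
  · exact absurd h hx.ne_zero
  · exact h

theorem le_of_two_le (hx : HasFirstDigit α x b) (h0 : 1 / 2 ≤ α) (hb : 2 ≤ b) :
    x * (1 + α) ≤ 1 := by
  have hpos := hx.pos h0 (by omega)
  have hb' : (2 : ℝ) ≤ b := by exact_mod_cast hb
  have := hx.mul_T
  have hT := hx.T_mem.1
  nlinarith

theorem half_lt_of_one (hx : HasFirstDigit α x 1) (h0 : 1 / 2 ≤ α) (h1 : α ≤ 1) : 1 / 2 < x := by
  have hpos := hx.pos h0 (by omega)
  have := hx.mul_T
  have hT := hx.T_mem.2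
  push_cast at this
  nlinarith

theorem T_pos_of_one (hx : HasFirstDigit α x 1) (h0 : 1 / 2 ≤ α) (h1 : α ≤ 1) : 0 < T α x := by
  have hpos := hx.pos h0 (by omega)
  have := hx.mul_T
  have hxα := hx.mem.2
  push_cast at this
  by_contra! h
  nlinarith

theorem le_g (hx : HasFirstDigit α x b) (h0 : 1 / 2 ≤ α) (h1 : α ≤ 1) (hαg : g ≤ α)
    (hb : b ≠ 1) : x ≤ g := by
  rcases lt_or_gt_of_ne hx.ne_zero with h | h
  · linarith [g_gt]
  · have := hx.digit_pos h1 h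
    have := hx.le_of_two_le h0 (by omega)
    nlinarith [g_sq, g_gt]

theorem abs_le_g (hx : HasFirstDigit α x b) (h0 : 1 / 2 ≤ α) (h1 : α ≤ 1)
    (hb : α ≤ g ∨ b ≠ 1) : |x| ≤ g := by
  obtain ⟨hl, hr⟩ := hx.mem
  rw [abs_le]
  refine ⟨by linarith [g_gt], ?_⟩
  rcases le_total α g with h | h
  · linarith
  · rcases hb with hb | hb
    · linarith
    · exact hx.le_g h0 h1 h hb

theorem abs_sub_le_half (hx : HasFirstDigit α x b) (hy : HasFirstDigit α y b)
    (h0 : 1 / 2 ≤ α) (h1 : α ≤ 1) : |x - y| ≤ 1 / 2 := by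
  obtain ⟨hxl, hxr⟩ := hx.mem
  obtain ⟨hyl, hyr⟩ := hy.mem
  rcases lt_or_gt_of_ne hx.ne_zero with h | h
  · have hb := hx.digit_neg h0 h
    have hy0 : y < 0 := by
      by_contra! hy0
      have := hy.digit_pos h1 (lt_of_le_of_ne hy0 hy.ne_zero.symm)
      omega
    rw [abs_le]
    constructor <;> linarith
  · have hb := hx.digit_pos h1 h
    have hy0 := hy.pos h0 (by omega)
    rcases hb.eq_or_lt with rfl | hb
    · have := hx.half_lt_of_one h0 h1
      have := hy.half_lt_of_one h0 h1
      rw [abs_le]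
      constructor <;> linarith
    · have h3 := hx.le_of_two_le h0 hb
      have h4 := hy.le_of_two_le h0 hb
      have h5 : x ≤ 2 / 3 := by nlinarith
      have h6 : y ≤ 2 / 3 := by nlinarith
      rw [hx.abs_sub_eq hy, abs_of_pos h, abs_of_pos hy0]
      have := hx.abs_T_sub_le_one hy
      calc x * y * |T α x - T α y| ≤ (2 / 3) * (2 / 3) * 1 := by gcongr
        _ ≤ 1 / 2 := by norm_num

/-- The map `T α` expands the density `(x + 1 + g)⁻²` by at least `g⁻²`. -/
theorem abs_mul_T_add_le (hx : HasFirstDigit α x b) (h1 : α ≤ 1) (hαg : g ≤ α) :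
    |x| * (T α x + 1 + g) ≤ g * (x + 1 + g) := by
  have hm := hx.mul_T
  obtain ⟨hxl, hxr⟩ := hx.mem
  obtain ⟨hTl, hTr⟩ := hx.T_mem
  have hg := g_sq
  have hg1 := g_gt
  have hg2 := g_lt
  rcases lt_or_gt_of_ne hx.ne_zero with h | h
  · rw [abs_of_neg h]
    obtain ⟨y, rfl⟩ : ∃ y, x = -y := ⟨-x, by ring⟩
    have hy : 0 < y := by linarith
    set t := T α (-y)
    suffices y * (t + 1 + 2 * g) ≤ 1 by nlinarith
    rcases le_or_gt b (-4) with hb | hb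
    · have hb' : (b : ℝ) ≤ -4 := by exact_mod_cast hb
      rcases le_total α 0.88 with h2 | h2
      · nlinarith
      · nlinarith
    · have hb' : (-3 : ℝ) ≤ b := by exact_mod_cast (show -3 ≤ b by omega)
      have : y ≤ g ^ 2 := by linarith
      have : y * (2 + g) ≤ 1 := by nlinarith
      nlinarith
  · have hb : (1 : ℝ) ≤ b := by exact_mod_cast hx.digit_pos h1 h
    rw [abs_of_pos h]
    nlinarith

theorem abs_sub_le_weighted (hx : HasFirstDigit α x b) (hy : HasFirstDigit α y b)
    (h0 : 1 / 2 ≤ α) (h1 : α ≤ 1) (hαg : g ≤ α) :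
    |x - y| ≤ g ^ 2 / 4 * ((x + 1 + g) * (y + 1 + g)) := by
  have hg := g_sq
  have hg1 := g_gt
  have hg2 := g_lt
  by_cases hb : b = 1
  · subst hb
    have hx1 := hx.half_lt_of_one h0 h1
    have hy1 := hy.half_lt_of_one h0 h1
    have hx2 := hx.mem.2.trans_le h1
    have hy2 := hy.mem.2.trans_le h1
    have e : g ^ 2 / 4 * ((x + 1 + g) * (y + 1 + g)) = (g * x + 1) * (g * y + 1) / 4 := by
      linear_combination (g * x + g * y + g ^ 2 + g + 1) / 4 * hg
    rw [e]
    have hxl : 0.618 * x + 1 ≤ g * x + 1 := by nlinarith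
    have hyl : 0.618 * y + 1 ≤ g * y + 1 := by nlinarith
    have hl : (0.618 * x + 1) * (0.618 * y + 1) ≤ (g * x + 1) * (g * y + 1) := by gcongr
    rw [abs_le]
    constructor <;>
      nlinarith [mul_pos (sub_pos.2 hx1) (sub_pos.2 hy2), mul_pos (sub_pos.2 hy1) (sub_pos.2 hx2)]
  · have key : ∀ z, HasFirstDigit α z b → |z| ≤ g / 2 * (z + 1 + g) := by
      intro z hz
      have hzg := hz.le_g h0 h1 hαg hb
      have hzl := hz.mem.1
      rcases abs_cases z with ⟨h, _⟩ | ⟨h, _⟩ <;> rw [h] <;> nlinarith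
    have h3 := key x hx
    have h4 := key y hy
    rw [hx.abs_sub_eq hy]
    calc |x| * |y| * |T α x - T α y| ≤ |x| * |y| * 1 := by
          gcongr
          exact hx.abs_T_sub_le_one hy
      _ ≤ (g / 2 * (x + 1 + g)) * (g / 2 * (y + 1 + g)) * 1 := by
          gcongr
          exact (abs_nonneg _).trans h3
      _ = _ := by ring

end HasFirstDigit

theorem abs_sub_le_weighted_of_mem_cylinder {α : ℝ} (h0 : 1 / 2 ≤ α) (h1 : α ≤ 1)
    (hαg : g ≤ α) (m : ℕ) : ∀ a : ℕ → ℤ, (∀ k, 1 ≤ k → k ≤ m + 1 → a k ≠ 0) →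
    ∀ x ∈ cylinder α (m + 1) a, ∀ y ∈ cylinder α (m + 1) a,
      |x - y| ≤ g ^ (2 * m) * (g ^ 2 / 4 * ((x + 1 + g) * (y + 1 + g))) := by
  have hg := g_gt
  induction m with
  | zero =>
    intro a ha x hx y hy
    have ha1 := ha 1 le_rfl le_rfl
    have := (HasFirstDigit.of_mem_cylinder le_rfl ha1 hx).abs_sub_le_weighted
      (.of_mem_cylinder le_rfl ha1 hy) h0 h1 hαg
    simpa using this
  | succ m ih =>
    intro a ha x hx y hy
    have ha1 := ha 1 le_rfl (by omega)
    have hX := HasFirstDigit.of_mem_cylinder (by omega) ha1 hx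
    have hY := HasFirstDigit.of_mem_cylinder (by omega) ha1 hy
    have hT := ih _ (fun k hk hkm => ha (k + 1) (by omega) (by omega)) _
      (T_mem_cylinder ha1 hx) _ (T_mem_cylinder ha1 hy)
    have hwx := hX.abs_mul_T_add_le h1 hαg
    have hwy := hY.abs_mul_T_add_le h1 hαg
    have hTx : 0 ≤ T α x + 1 + g := by linarith [hX.T_mem.1]
    have hTy : 0 ≤ T α y + 1 + g := by linarith [hY.T_mem.1]
    rw [hX.abs_sub_eq hY]
    calc |x| * |y| * |T α x - T α y|
        ≤ |x| * |y| * (g ^ (2 * m) * (g ^ 2 / 4 * ((T α x + 1 + g) * (T α y + 1 + g)))) := by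
          gcongr
      _ = g ^ (2 * m) * (g ^ 2 / 4) *
            ((|x| * (T α x + 1 + g)) * (|y| * (T α y + 1 + g))) := by ring
      _ ≤ g ^ (2 * m) * (g ^ 2 / 4) * ((g * (x + 1 + g)) * (g * (y + 1 + g))) := by
          have : 0 ≤ |x| * (T α x + 1 + g) := by positivity
          gcongr
          linarith
      _ = _ := by ring

theorem abs_sub_le_of_mem_cylinder {α : ℝ} (h0 : 1 / 2 ≤ α) (h1 : α ≤ 1) (n : ℕ) :
    ∀ a : ℕ → ℤ, (∀ k, 1 ≤ k → k ≤ n + 1 → a k ≠ 0) →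
    ∀ x ∈ cylinder α (n + 1) a, ∀ y ∈ cylinder α (n + 1) a, |x - y| ≤ g ^ (2 * n) / 2 := by
  have hg := g_gt
  have hg2 := g_lt
  have hgs := g_sq
  induction n using Nat.strong_induction_on with
  | _ n ih =>
    intro a ha x hx y hy
    have ha1 := ha 1 le_rfl (by omega)
    have hX := HasFirstDigit.of_mem_cylinder (by omega) ha1 hx
    have hY := HasFirstDigit.of_mem_cylinder (by omega) ha1 hy
    rcases n with _ | n
    · simpa using hX.abs_sub_le_half hY h0 h1
    have hTx := T_mem_cylinder ha1 hx
    have hTy := T_mem_cylinder ha1 hy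
    by_cases hc : α ≤ g ∨ a 1 ≠ 1
    · have hxg := hX.abs_le_g h0 h1 hc
      have hyg := hY.abs_le_g h0 h1 hc
      have hT := ih n (by omega) _ (fun k hk hkm => ha (k + 1) (by omega) (by omega)) _ hTx _ hTy
      rw [hX.abs_sub_eq hY]
      calc |x| * |y| * |T α x - T α y| ≤ g * g * (g ^ (2 * n) / 2) := by gcongr
        _ = _ := by ring
    push Not at hc
    obtain ⟨hαg, hb⟩ := hc
    rw [hb] at hX hY
    have hx0 := hX.pos h0 one_pos
    have hy0 := hY.pos h0 one_pos
    have ha2 : a (1 + 1) ≠ 0 := ha 2 (by omega) (by omega)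
    have hX' := HasFirstDigit.of_mem_cylinder (by omega) ha2 hTx
    have hY' := HasFirstDigit.of_mem_cylinder (by omega) ha2 hTy
    by_cases hb2 : a (1 + 1) = 1
    · have hW := abs_sub_le_weighted_of_mem_cylinder h0 h1 hαg.le _ a ha x hx y hy
      simp only [hb2] at hX' hY'
      have key : ∀ z, HasFirstDigit α z 1 → HasFirstDigit α (T α z) 1 →
          g * (z + 1 + g) ≤ 1.413 := by
        intro z hz hz'
        have hz0 := hz.pos h0 one_pos
        have hT := hz'.half_lt_of_one h0 h1
        have := hz.mul_T
        push_cast at this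
        have : z ≤ 2 / 3 := by nlinarith
        nlinarith
      have hkx := key x hX hX'
      have hky := key y hY hY'
      calc |x - y| ≤ _ := hW
        _ = g ^ (2 * (n + 1)) * (g * (x + 1 + g) * (g * (y + 1 + g)) / 4) := by ring
        _ ≤ g ^ (2 * (n + 1)) * (1.413 * 1.413 / 4) := by gcongr
        _ ≤ g ^ (2 * (n + 1)) * (1 / 2) :=
            mul_le_mul_of_nonneg_left (by norm_num) (by positivity)
        _ = _ := by ring
    · have key : ∀ z, HasFirstDigit α z 1 → HasFirstDigit α (T α z) (a (1 + 1)) →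
          |z| * |T α z| ≤ g ^ 2 := by
        intro z hz hz'
        have hz0 := hz.pos h0 one_pos
        have hT := hz.T_pos_of_one h0 h1
        have hTg := hz'.le_g h0 h1 hαg.le hb2
        have := hz.mul_T
        push_cast at this
        rw [abs_of_pos hz0, abs_of_pos hT]
        nlinarith
      have hkx := key x hX hX'
      have hky := key y hY hY'
      have e : |x - y| = (|x| * |T α x|) * (|y| * |T α y|) * |T α (T α x) - T α (T α y)| := by
        rw [hX.abs_sub_eq hY, hX'.abs_sub_eq hY']
        ring
      rw [e]
      rcases n with _ | n
      · calc _ ≤ g ^ 2 * g ^ 2 * 1 := by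
              gcongr
              exact hX'.abs_T_sub_le_one hY'
          _ ≤ _ := by nlinarith
      · have hT := ih n (by omega) _ (fun k hk hkm => ha (k + 1 + 1) (by omega) (by omega)) _
          (T_mem_cylinder ha2 hTx) _ (T_mem_cylinder ha2 hTy)
        calc _ ≤ g ^ 2 * g ^ 2 * (g ^ (2 * n) / 2) := by gcongr
          _ = _ := by ring

/-- For α ∈ [1/2, 1] and every cylinder set ⟨a_1, …, a_n⟩ with n ≥ 1,
λ(⟨a_1, …, a_n⟩) ≤ g^{2(n−1)} / 2. -/
theorem cylinder_measure_le (α : ℝ) (hα : α ∈ Set.Icc (1 / 2 : ℝ) 1)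
    (n : ℕ) (hn : 1 ≤ n) (a : ℕ → ℤ) (ha : ∀ k, 1 ≤ k → k ≤ n → a k ≠ 0) :
    volume (cylinder α n a) ≤ ENNReal.ofReal (g ^ (2 * (n - 1)) / 2) := by
  obtain ⟨n, rfl⟩ := Nat.exists_eq_add_of_le' hn
  refine (Real.volume_le_diam _).trans (Metric.ediam_le fun x hx y hy => ?_)
  rw [edist_dist, Real.dist_eq]
  exact ENNReal.ofReal_le_ofReal (abs_sub_le_of_mem_cylinder hα.1 hα.2 n a ha x hx y hy)
end

section
/- For α ∈ [1/2, 1], any admissible sequence a_1, …, a_n with continuants q_{n−1}, q_n, and any y ∈ T_α^n(⟨a_1, …, a_n⟩), one has g^4 q_n^2 < (q_{n−1} y + q_n)^2 < 9 q_n^2; equivalently, the derivative of the local inverse ψ_{a_1,…,a_n}(y) = (p_{n−1} y + p_n)/(q_{n−1} y + q_n) of T_α^n restricted to ⟨a_1, …, a_n⟩ satisfies 1/(9 q_n^2) < |ψ′_{a_1,…,a_n}(y)| < 1/(g^4 q_n^2). -/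
open MeasureTheory Set

/-- A region containing every pair `(T_α^n x, q_{n-1} / q_n)`. -/
def DistortionRegion (x v : ℝ) : Prop :=
  -1 ≤ v ∧ v ≤ 2 ∧ (0 < x → -1 / 2 ≤ v) ∧ (x < 0 → v ≤ 2 / 3)

lemma T_mem_Ico (α : ℝ) (hα : α ∈ Set.Icc (1 / 2 : ℝ) 1) (x : ℝ) :
    T α x ∈ Set.Ico (α - 1) α := by
  obtain ⟨h1, h2⟩ := hα
  unfold T
  split_ifs with h
  · constructor <;> linarith
  · have h3 := Int.floor_le (1 / x + 1 - α)
    have h4 := Int.lt_floor_add_one (1 / x + 1 - α)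
    constructor <;> linarith

lemma iterate_T_mem_Ico (α : ℝ) (hα : α ∈ Set.Icc (1 / 2 : ℝ) 1) (x : ℝ)
    (hx : x ∈ Set.Ico (α - 1) α) : ∀ n : ℕ, (T α)^[n] x ∈ Set.Ico (α - 1) α
  | 0 => hx
  | n + 1 => by
    rw [Function.iterate_succ_apply']
    exact T_mem_Ico α hα _

lemma DistortionRegion.step {α x v : ℝ} (hα : α ∈ Set.Icc (1 / 2 : ℝ) 1)
    (hx : x ∈ Set.Ico (α - 1) α) (hx0 : x ≠ 0) (h : DistortionRegion x v) :
    (⌊1 / x + 1 - α⌋ : ℝ) + v ≠ 0 ∧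
      DistortionRegion (T α x) (1 / ((⌊1 / x + 1 - α⌋ : ℝ) + v)) := by
  obtain ⟨hα1, hα2⟩ := hα
  obtain ⟨hx1, hx2⟩ := hx
  obtain ⟨hv1, hv2, hv3, hv4⟩ := h
  rw [show T α x = 1 / x - ⌊1 / x + 1 - α⌋ from if_neg hx0]
  have hf1 := Int.floor_le (1 / x + 1 - α)
  have hf2 := Int.lt_floor_add_one (1 / x + 1 - α)
  generalize ⌊1 / x + 1 - α⌋ = a at *
  rcases lt_or_gt_of_ne hx0 with hneg | hpos
  · have hv := hv4 hneg
    have ht : 1 / x ≤ -2 := by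
      rw [div_le_iff_of_neg hneg]; linarith
    have ha : a ≤ -2 := by
      have : (a : ℝ) < ((-1 : ℤ) : ℝ) := by push_cast; linarith
      have := Int.cast_lt.mp this
      omega
    have ha' : (a : ℝ) ≤ -2 := by exact_mod_cast ha
    have hd : (a : ℝ) + v < 0 := by linarith
    have hw : 1 / ((a : ℝ) + v) < 0 := one_div_neg.mpr hd
    refine ⟨hd.ne, ?_, by linarith, fun hx' => ?_, fun _ => by linarith⟩
    · rw [le_div_iff_of_neg hd]; linarith
    · have ha3 : a ≤ -3 := by
        have : (a : ℝ) < ((-2 : ℤ) : ℝ) := by push_cast; linarith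
        have := Int.cast_lt.mp this
        omega
      have ha3' : (a : ℝ) ≤ -3 := by exact_mod_cast ha3
      rw [le_div_iff_of_neg hd]; linarith
  · have hv := hv3 hpos
    have ht : 1 < 1 / x := by
      rw [lt_div_iff₀ hpos]; linarith
    have ha : 1 ≤ a := by
      have : ((0 : ℤ) : ℝ) < a := by push_cast; linarith
      exact Int.cast_lt.mp this
    have ha' : (1 : ℝ) ≤ a := by exact_mod_cast ha
    have hd : 0 < (a : ℝ) + v := by linarith
    have hw : 0 < 1 / ((a : ℝ) + v) := one_div_pos.mpr hd
    refine ⟨hd.ne', by linarith, ?_, fun _ => by linarith, fun hx' => ?_⟩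
    · rw [div_le_iff₀ hd]; linarith
    · have ha2 : 2 ≤ a := by
        have : ((1 : ℤ) : ℝ) < a := by push_cast; linarith
        exact Int.cast_lt.mp this
      have ha2' : (2 : ℝ) ≤ a := by exact_mod_cast ha2
      rw [div_le_iff₀ hd]; linarith

lemma distortionRegion_cylinder {α : ℝ} (hα : α ∈ Set.Icc (1 / 2 : ℝ) 1) {N : ℕ} {a : ℕ → ℤ}
    (ha : ∀ k, 1 ≤ k → k ≤ N → a k ≠ 0) {x : ℝ} (hx : x ∈ cylinder α N a) (n : ℕ)
    (hn : n + 1 ≤ N) :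
    (contQ a (n + 1) : ℝ) ≠ 0 ∧
      DistortionRegion ((T α)^[n + 1] x) ((contQ a n : ℝ) / contQ a (n + 1)) := by
  have key : ∀ k, k + 1 ≤ N → (T α)^[k] x ≠ 0 ∧ ⌊1 / (T α)^[k] x + 1 - α⌋ = a (k + 1) := by
    intro k hk
    have hdig := hx.2 (k + 1) (by omega) hk
    have hne := ha (k + 1) (by omega) hk
    simp only [digit, Nat.add_sub_cancel] at hdig
    split_ifs at hdig with h0
    · exact absurd hdig.symm hne
    · exact ⟨h0, hdig⟩
  have next : ∀ k, k + 1 ≤ N → ∀ v, DistortionRegion ((T α)^[k] x) v →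
      (a (k + 1) : ℝ) + v ≠ 0 ∧
        DistortionRegion ((T α)^[k + 1] x) (1 / ((a (k + 1) : ℝ) + v)) := by
    intro k hk v hv
    have hstep := hv.step hα (iterate_T_mem_Ico α hα x hx.1 k) (key k hk).1
    rwa [(key k hk).2, ← Function.iterate_succ_apply' (T α)] at hstep
  induction n with
  | zero =>
    have h := next 0 hn 0 (by norm_num [DistortionRegion])
    simpa [contQ] using h
  | succ n ih =>
    obtain ⟨hq, hr⟩ := ih (by omega)
    obtain ⟨h1, h2⟩ := next (n + 1) hn _ hr
    have hrec : (contQ a (n + 1 + 1) : ℝ) =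
        contQ a (n + 1) * ((a (n + 1 + 1) : ℝ) + (contQ a n : ℝ) / contQ a (n + 1)) := by
      simp only [contQ]
      push_cast
      field_simp
    have hquot : (contQ a (n + 1) : ℝ) / contQ a (n + 1 + 1) =
        1 / ((a (n + 1 + 1) : ℝ) + (contQ a n : ℝ) / contQ a (n + 1)) := by
      rw [hrec, ← div_div, div_self hq]
    rw [hquot]
    exact ⟨hrec ▸ mul_ne_zero hq h1, h2⟩

/-- The determinant identity for continuants. -/
lemma contP_mul_contQ_sub (a : ℕ → ℤ) (n : ℕ) :
    contP a n * contQ a (n + 1) - contP a (n + 1) * contQ a n = (-1) ^ (n + 1) := by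
  induction n with
  | zero => simp [contP, contQ]
  | succ n ih =>
    simp only [contP, contQ]
    rw [pow_succ, ← ih]
    ring

lemma DistortionRegion.one_add_mul_mem {α x v : ℝ} (hα : α ∈ Set.Icc (1 / 2 : ℝ) 1)
    (hx : x ∈ Set.Ico (α - 1) α) (h : DistortionRegion x v) :
    1 + v * x ∈ Set.Ioo (4 / 9 : ℝ) 3 := by
  obtain ⟨hα1, hα2⟩ := hα
  obtain ⟨hx1, hx2⟩ := hx
  obtain ⟨hv1, hv2, hv3, hv4⟩ := h
  rcases lt_trichotomy x 0 with hneg | rfl | hpos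
  · have := hv4 hneg
    constructor <;> nlinarith
  · norm_num
  · have := hv3 hpos
    constructor <;> nlinarith

lemma g_pos : 0 < g := by
  have : (1 : ℝ) < Real.sqrt 5 := by
    rw [Real.lt_sqrt] <;> norm_num
  unfold g
  linarith

lemma g_sq_lt : g ^ 2 < 4 / 9 := by
  have : Real.sqrt 5 < 7 / 3 := by
    rw [Real.sqrt_lt'] <;> norm_num
  have hg : g < 2 / 3 := by
    unfold g
    linarith
  nlinarith [g_pos]

/-- Bounded distortion: for any admissible sequence a_1, …, a_n and any
y ∈ T_α^n(⟨a_1, …, a_n⟩), one has g⁴ q_n² < (q_{n−1} y + q_n)² < 9 q_n²;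
equivalently, the derivative of the local inverse
ψ(y) = (p_{n−1} y + p_n)/(q_{n−1} y + q_n) satisfies 1/(9 q_n²) < |ψ′(y)| < 1/(g⁴ q_n²). -/
theorem bounded_distortion (α : ℝ) (hα : α ∈ Set.Icc (1 / 2 : ℝ) 1)
    (n : ℕ) (hn : 1 ≤ n) (a : ℕ → ℤ) (ha : ∀ k, 1 ≤ k → k ≤ n → a k ≠ 0)
    (hadm : (interior (cylinder α n a)).Nonempty)
    (y : ℝ) (hy : y ∈ (T α)^[n] '' cylinder α n a) :
    (g ^ 4 * (contQ a n : ℝ) ^ 2 < ((contQ a (n - 1) : ℝ) * y + (contQ a n : ℝ)) ^ 2 ∧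
      ((contQ a (n - 1) : ℝ) * y + (contQ a n : ℝ)) ^ 2 < 9 * (contQ a n : ℝ) ^ 2) ∧
    (1 / (9 * (contQ a n : ℝ) ^ 2) <
        |deriv (fun t : ℝ =>
          ((contP a (n - 1) : ℝ) * t + (contP a n : ℝ)) /
            ((contQ a (n - 1) : ℝ) * t + (contQ a n : ℝ))) y| ∧
      |deriv (fun t : ℝ =>
          ((contP a (n - 1) : ℝ) * t + (contP a n : ℝ)) /
            ((contQ a (n - 1) : ℝ) * t + (contQ a n : ℝ))) y| <
        1 / (g ^ 4 * (contQ a n : ℝ) ^ 2)) := by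
  obtain ⟨x, hx, rfl⟩ := hy
  obtain ⟨m, rfl⟩ : ∃ m, n = m + 1 := ⟨n - 1, by omega⟩
  obtain ⟨hq, hr⟩ := distortionRegion_cylinder hα ha hx m le_rfl
  have hmem := hr.one_add_mul_mem hα (iterate_T_mem_Ico α hα x hx.1 (m + 1))
  have hdet : (contP a m * contQ a (m + 1) - contP a (m + 1) * contQ a m : ℝ) =
      (-1) ^ (m + 1) := by
    exact_mod_cast contP_mul_contQ_sub a m
  simp only [Nat.add_sub_cancel]
  generalize (T α)^[m + 1] x = y at *
  generalize (contQ a m : ℝ) = r, (contQ a (m + 1) : ℝ) = q, (contP a m : ℝ) = s,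
    (contP a (m + 1) : ℝ) = p at *
  have hfac : r * y + q = q * (1 + r / q * y) := by field_simp; ring
  obtain ⟨hl, hu⟩ := hmem
  have hq2 : 0 < q ^ 2 := by positivity
  have hg := g_pos
  have hbound : g ^ 4 * q ^ 2 < (r * y + q) ^ 2 ∧ (r * y + q) ^ 2 < 9 * q ^ 2 := by
    rw [hfac, mul_pow, mul_comm (q ^ 2)]
    have hg2 := g_sq_lt
    constructor
    · refine mul_lt_mul_of_pos_right ?_ hq2
      rw [show g ^ 4 = (g ^ 2) ^ 2 by ring]
      exact pow_lt_pow_left₀ (hg2.trans hl) (by positivity) two_ne_zero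
    · refine mul_lt_mul_of_pos_right ?_ hq2
      nlinarith
  refine ⟨hbound, ?_⟩
  have hden : r * y + q ≠ 0 := by
    rw [hfac]
    exact mul_ne_zero hq (by linarith)
  have hderiv : HasDerivAt (fun t : ℝ => (s * t + p) / (r * t + q))
      ((-1) ^ (m + 1) / (r * y + q) ^ 2) y := by
    have h1 : HasDerivAt (fun t : ℝ => s * t + p) s y := by
      simpa using ((hasDerivAt_id y).const_mul s).add_const p
    have h2 : HasDerivAt (fun t : ℝ => r * t + q) r y := by
      simpa using ((hasDerivAt_id y).const_mul r).add_const q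
    refine (h1.div h2 hden).congr_deriv ?_
    rw [← hdet]
    ring
  rw [hderiv.deriv, abs_div, abs_pow, abs_neg, abs_one, one_pow, abs_of_nonneg (sq_nonneg _)]
  exact ⟨one_div_lt_one_div_of_lt (by positivity) hbound.2,
    one_div_lt_one_div_of_lt (by positivity) hbound.1⟩
end
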